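/- arXiv:2003.08584 — 4 statements merged into one kernel-verified Lean document; each statement's English description precedes it below -/
import Mathlib

section
/- Let f be absolutely continuous on [−1, 1] with f(−1) = f(1) = 0 and f′(x)/(1 − |x|) ∈ L¹[−1, 1]. Then (j₁′²/3)·∫₋₁¹ |f(x)|/(1 − |x|) dx ≤ ∫₋₁¹ |f′(x)|/(1 − |x|) dx − (1/3)·∫₋₁¹ |f′(x)| dx, where j₁′ is the first positive zero of the derivative J₁′ of the Bessel function J₁ of order 1. -/
open MeasureTheory Real Set Filter

/-- Bessel function of the first kind of real order `ν`, defined for `x > 0` by its series. -/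
noncomputable def besselJ (ν x : ℝ) : ℝ :=
  ∑' k : ℕ, (-1 : ℝ) ^ k * x ^ (2 * (k : ℝ) + ν) /
    (2 ^ (2 * (k : ℝ) + ν) * (Nat.factorial k : ℝ) * Real.Gamma ((k : ℝ) + 1 + ν))


/-- On positive arguments, `besselJ 1` is an alternating power series in half the argument. -/
theorem besselJ_one_two_mul {y : ℝ} (hy : 0 < y) :
    besselJ 1 (2 * y) =
      ∑' k : ℕ, (-1 : ℝ) ^ k * (y ^ (2 * k + 1) / ((k.factorial : ℝ) * (k + 1).factorial)) := by
  unfold besselJ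
  refine tsum_congr fun k => ?_
  have e : (2 * (k : ℝ) + 1) = ((2 * k + 1 : ℕ) : ℝ) := by push_cast; ring
  have g : Real.Gamma ((k : ℝ) + 1 + 1) = ((k + 1).factorial : ℝ) := by
    rw [← Real.Gamma_nat_eq_factorial]; push_cast; rfl
  rw [g, e, Real.rpow_natCast, Real.rpow_natCast, mul_pow]
  have h1 : (k.factorial : ℝ) ≠ 0 := by positivity
  have h2 : ((k + 1).factorial : ℝ) ≠ 0 := by positivity
  field_simp

theorem antitone_besselJ_one_terms {y : ℝ} (hy : 0 < y) (hy2 : y ^ 2 ≤ 2) :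
    Antitone fun k : ℕ => y ^ (2 * k + 1) / ((k.factorial : ℝ) * (k + 1).factorial) := by
  refine antitone_nat_of_succ_le fun k => ?_
  have e : y ^ (2 * (k + 1) + 1) / (((k + 1).factorial : ℝ) * (k + 1 + 1).factorial) =
      y ^ (2 * k + 1) / ((k.factorial : ℝ) * (k + 1).factorial) *
        (y ^ 2 / ((k + 1) * (k + 2))) := by
    rw [Nat.factorial_succ (k + 1), Nat.factorial_succ k]
    push_cast
    have h1 : (k.factorial : ℝ) ≠ 0 := by positivity
    field_simp
    ring
  rw [e]
  refine mul_le_of_le_one_right (by positivity) ?_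
  rw [div_le_one (by positivity)]
  nlinarith [(Nat.cast_nonneg k : (0 : ℝ) ≤ k)]

theorem tendsto_besselJ_one_partial_sums {y : ℝ} (hy : 0 < y) :
    Tendsto (fun n => ∑ k ∈ Finset.range n,
      (-1 : ℝ) ^ k * (y ^ (2 * k + 1) / ((k.factorial : ℝ) * (k + 1).factorial)))
      atTop (nhds (besselJ 1 (2 * y))) := by
  rw [besselJ_one_two_mul hy]
  refine HasSum.tendsto_sum_nat (Summable.hasSum ?_)
  refine Summable.of_norm_bounded ((Real.summable_pow_div_factorial (y ^ 2)).mul_left y)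
    fun k => ?_
  have h1 : (1 : ℝ) ≤ (k + 1).factorial := by
    exact_mod_cast Nat.one_le_iff_ne_zero.2 (by positivity)
  rw [norm_mul, norm_pow, norm_neg, norm_one, one_pow, one_mul, Real.norm_of_nonneg (by positivity),
    pow_succ, pow_mul, mul_comm, ← mul_div_assoc]
  gcongr
  exact le_mul_of_one_le_right (by positivity) h1

/-- The first critical point of `besselJ 1` is below `12 / 5`. -/
theorem besselJ_one_first_critical_point_le {j : ℝ}
    (hj : ∀ t ∈ Set.Ioo 0 j, deriv (besselJ 1) t ≠ 0) : j ≤ 12 / 5 := by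
  by_contra! h
  have low : besselJ 1 (1 / 2) ≤ 1 / 4 := by
    have := (antitone_besselJ_one_terms (y := 1 / 4) (by norm_num)
      (by norm_num)).tendsto_le_alternating_series
      (tendsto_besselJ_one_partial_sums (y := 1 / 4) (by norm_num)) 0
    norm_num [Finset.sum_range_succ, Nat.factorial] at this ⊢
    linarith
  have mid : 83 / 144 ≤ besselJ 1 2 := by
    have := (antitone_besselJ_one_terms (y := 1) (by norm_num)
      (by norm_num)).alternating_series_le_tendsto
      (tendsto_besselJ_one_partial_sums (y := 1) (by norm_num)) 2
    norm_num [Finset.sum_range_succ, Nat.factorial] at this ⊢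
    linarith
  have high : besselJ 1 (12 / 5) ≤ 11 / 20 := by
    have := (antitone_besselJ_one_terms (y := 6 / 5) (by norm_num)
      (by norm_num)).tendsto_le_alternating_series
      (tendsto_besselJ_one_partial_sums (y := 6 / 5) (by norm_num)) 1
    norm_num [Finset.sum_range_succ, Nat.factorial] at this ⊢
    linarith
  have hc : ContinuousOn (besselJ 1) (Set.Icc (1 / 2) (12 / 5)) := fun t ht =>
    (differentiableAt_of_deriv_ne_zero
      (hj t ⟨by linarith [ht.1], by linarith [ht.2]⟩)).continuousAt.continuousWithinAt
  obtain ⟨c, hcm, hmax⟩ := isCompact_Icc.exists_isMaxOn ⟨1 / 2, by norm_num⟩ hc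
  have h2 : besselJ 1 2 ≤ besselJ 1 c := hmax ⟨by norm_num, by norm_num⟩
  have hl : 1 / 2 < c := lt_of_le_of_ne hcm.1 fun e => by rw [← e] at h2; linarith
  have hr : c < 12 / 5 := lt_of_le_of_ne hcm.2 fun e => by rw [e] at h2; linarith
  exact hj c ⟨by linarith, by linarith⟩ (hmax.isLocalMax (Icc_mem_nhds hl hr)).deriv_eq_zero

theorem neg_log_le_inv {t : ℝ} (ht : 0 < t) : 2 * -Real.log t ≤ 1 / t - 1 / 3 := by
  have h := Real.log_le_sub_one_of_pos (x := 1 / (2 * t)) (by positivity)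
  rw [one_div, Real.log_inv, Real.log_mul (by norm_num) ht.ne', mul_inv] at h
  have := Real.log_two_lt_d9
  rw [one_div]
  linarith

theorem integral_indicator_Ioi_inv {t : ℝ} (ht : t ∈ Set.Ioo (0 : ℝ) 1) (c : ℝ) :
    IntegrableOn (fun u => (Set.Ioi t).indicator (fun u => c / u) u) (Set.Ioo 0 1) ∧
      ∫ u in Set.Ioo (0 : ℝ) 1, (Set.Ioi t).indicator (fun u => c / u) u = c * -Real.log t := by
  have hi : Set.Ioo (0 : ℝ) 1 ∩ Set.Ioi t = Set.Ioo t 1 := by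
    ext u; simp only [Set.mem_inter_iff, Set.mem_Ioo, Set.mem_Ioi]
    have := ht.1
    constructor
    · rintro ⟨⟨_, h⟩, h'⟩; exact ⟨h', h⟩
    · rintro ⟨h, h'⟩; exact ⟨⟨by linarith, h'⟩, h⟩
  constructor
  · rw [integrableOn_indicator_iff measurableSet_Ioi, Set.inter_comm, hi]
    refine (ContinuousOn.integrableOn_Icc (fun u hu => ?_)).mono_set Set.Ioo_subset_Icc_self
    have : u ≠ 0 := (ht.1.trans_le hu.1).ne'
    exact (continuousAt_const.div continuousAt_id this).continuousWithinAt
  · rw [setIntegral_indicator measurableSet_Ioi, hi, ← integral_Ioc_eq_integral_Ioo,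
      ← intervalIntegral.integral_of_le ht.2.le]
    simp_rw [div_eq_mul_inv]
    rw [intervalIntegral.integral_const_mul, integral_inv_of_pos ht.1 one_pos, one_div,
      Real.log_inv]

/-- A weighted Hardy-type inequality on the unit interval. -/
theorem two_mul_integral_div_le {h F : ℝ → ℝ} (hF0 : ∀ u ∈ Set.Ioo (0 : ℝ) 1, 0 ≤ F u)
    (hF : ∀ u ∈ Set.Ioo (0 : ℝ) 1, F u ≤ ∫ t in Set.Ioo 0 u, h t)
    (h0 : ∀ t, 0 ≤ h t) (hint : IntegrableOn h (Set.Ioo 0 1))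
    (hdiv : IntegrableOn (fun t => h t / t) (Set.Ioo 0 1)) :
    2 * ∫ u in Set.Ioo (0 : ℝ) 1, F u / u ≤
      (∫ t in Set.Ioo (0 : ℝ) 1, h t / t) - 1 / 3 * ∫ t in Set.Ioo (0 : ℝ) 1, h t := by
  set μ := (volume : Measure ℝ).restrict (Set.Ioo 0 1) with hμ
  set K : ℝ → ℝ → ℝ := fun u t => (Set.Ioi t).indicator (fun u => h t / u) u with hK
  have hmem : ∀ᵐ t ∂μ, t ∈ Set.Ioo (0 : ℝ) 1 := ae_restrict_mem measurableSet_Ioo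
  have hlog : Integrable (fun t => h t * -Real.log t) μ := by
    refine Integrable.mono' hdiv (hint.aestronglyMeasurable.mul
      (Real.measurable_log.neg.aestronglyMeasurable)) ?_
    filter_upwards [hmem] with t ht
    have hl : 0 ≤ -Real.log t := neg_nonneg.2 (Real.log_nonpos ht.1.le ht.2.le)
    rw [Real.norm_of_nonneg (mul_nonneg (h0 t) hl), div_eq_mul_one_div]
    refine mul_le_mul_of_nonneg_left ?_ (h0 t)
    linarith [neg_log_le_inv ht.1]
  have hmeas : AEStronglyMeasurable (Function.uncurry K) (μ.prod μ) := by
    have e : Function.uncurry K =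
        {p : ℝ × ℝ | p.2 < p.1}.indicator fun p => h p.2 / p.1 := by
      ext ⟨u, t⟩
      simp only [hK, Function.uncurry, Set.indicator, Set.mem_Ioi, Set.mem_ofPred_eq]
    rw [e]
    refine AEStronglyMeasurable.indicator ?_ (measurableSet_lt measurable_snd measurable_fst)
    exact (hint.aestronglyMeasurable.comp_snd).div₀
      measurable_fst.aestronglyMeasurable
  have hKint : Integrable (Function.uncurry K) (μ.prod μ) := by
    rw [integrable_prod_iff' hmeas]
    constructor
    · filter_upwards [hmem] with t ht
      exact (integral_indicator_Ioi_inv ht (h t)).1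
    · refine hlog.congr ?_
      filter_upwards [hmem] with t ht
      rw [← (integral_indicator_Ioi_inv ht (h t)).2]
      refine setIntegral_congr_fun measurableSet_Ioo fun u hu => ?_
      exact (Real.norm_of_nonneg
        (Set.indicator_apply_nonneg fun _ => div_nonneg (h0 t) hu.1.le)).symm
  have hbound : ∫ u, F u / u ∂μ ≤ ∫ u, ∫ t, K u t ∂μ ∂μ := by
    refine integral_mono_of_nonneg ?_ hKint.integral_prod_left ?_
    · filter_upwards [hmem] with u hu
      exact div_nonneg (hF0 u hu) hu.1.le
    · filter_upwards [hmem] with u hu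
      have e : (fun t => K u t) = (Set.Iio u).indicator fun t => h t / u := by
        ext t; simp only [hK, Set.indicator, Set.mem_Ioi, Set.mem_Iio]
      have hi : Set.Ioo (0 : ℝ) 1 ∩ Set.Iio u = Set.Ioo 0 u := by
        rw [Set.Ioo_inter_Iio, min_eq_right hu.2.le]
      have : ∫ t, K u t ∂μ = (∫ t in Set.Ioo 0 u, h t) / u := by
        rw [e, hμ, setIntegral_indicator measurableSet_Iio, hi, integral_div]
      refine le_of_le_of_eq ?_ this.symm
      exact div_le_div_of_nonneg_right (hF u hu) hu.1.le
  have hswap : ∫ u, ∫ t, K u t ∂μ ∂μ = ∫ t, h t * -Real.log t ∂μ := by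
    rw [integral_integral_swap hKint]
    refine integral_congr_ae ?_
    filter_upwards [hmem] with t ht
    exact (integral_indicator_Ioi_inv ht (h t)).2
  have hfin : 2 * ∫ t, h t * -Real.log t ∂μ ≤ (∫ t, h t / t ∂μ) - 1 / 3 * ∫ t, h t ∂μ := by
    rw [← integral_const_mul, ← integral_const_mul, ← integral_sub hdiv (hint.const_mul _)]
    refine integral_mono_ae (hlog.const_mul 2) (hdiv.sub (hint.const_mul _)) ?_
    filter_upwards [hmem] with t ht
    have := mul_le_mul_of_nonneg_left (neg_log_le_inv ht.1) (h0 t)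
    rw [div_eq_mul_one_div]
    linarith
  linarith

/-- Folding an integral over `(-1, 1)` onto the unit interval by distance to the endpoints. -/
theorem integral_Ioo_fold {φ : ℝ → ℝ} (hφ : IntegrableOn φ (Set.Ioo (-1) 1)) :
    IntegrableOn (fun u => φ (u - 1)) (Set.Ioo 0 1) ∧
    IntegrableOn (fun u => φ (1 - u)) (Set.Ioo 0 1) ∧
    ∫ x in Set.Ioo (-1 : ℝ) 1, φ x =
      (∫ u in Set.Ioo (0 : ℝ) 1, φ (u - 1)) + ∫ u in Set.Ioo (0 : ℝ) 1, φ (1 - u) := by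
  have hl : IntervalIntegrable φ volume (-1) 0 :=
    (intervalIntegrable_iff_integrableOn_Ioo_of_le (by norm_num)).2
      (hφ.mono_set (Set.Ioo_subset_Ioo_right (by norm_num)))
  have hr : IntervalIntegrable φ volume 0 1 :=
    (intervalIntegrable_iff_integrableOn_Ioo_of_le (by norm_num)).2
      (hφ.mono_set (Set.Ioo_subset_Ioo_left (by norm_num)))
  refine ⟨?_, ?_, ?_⟩
  · have := hl.comp_sub_right 1
    norm_num at this
    exact (intervalIntegrable_iff_integrableOn_Ioo_of_le (by norm_num)).1 this
  · have := (hr.comp_sub_left 1).symm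
    norm_num at this
    exact (intervalIntegrable_iff_integrableOn_Ioo_of_le (by norm_num)).1 this
  · simp only [← integral_Ioc_eq_integral_Ioo]
    rw [← intervalIntegral.integral_of_le (by norm_num),
      ← intervalIntegral.integral_of_le (by norm_num),
      ← intervalIntegral.integral_of_le (by norm_num),
      intervalIntegral.integral_comp_sub_right φ, intervalIntegral.integral_comp_sub_left φ]
    norm_num
    exact (intervalIntegral.integral_add_adjacent_intervals hl hr).symm

theorem stmt_8 (j1' : ℝ) (f f' : ℝ → ℝ)
    (hj_pos : 0 < j1') (hj_zero : deriv (besselJ 1) j1' = 0)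
    (hj_first : ∀ t ∈ Set.Ioo 0 j1', deriv (besselJ 1) t ≠ 0)
    (hf'int : IntegrableOn f' (Set.Icc (-1) 1))
    (hf : ∀ x ∈ Set.Icc (-1:ℝ) 1, f x = ∫ t in (-1:ℝ)..x, f' t)
    (hfb : f 1 = 0)
    (hL1 : IntegrableOn (fun x => f' x / (1 - |x|)) (Set.Ioo (-1) 1)) :
    j1' ^ 2 / 3 * (∫ x in Set.Ioo (-1:ℝ) 1, |f x| / (1 - |x|))
      ≤ (∫ x in Set.Ioo (-1:ℝ) 1, |f' x| / (1 - |x|))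
        - 1 / 3 * (∫ x in Set.Ioo (-1:ℝ) 1, |f' x|) := by
  have hj2 : j1' ^ 2 / 3 ≤ 2 := by
    have := besselJ_one_first_critical_point_le hj_first
    nlinarith
  have hint : IntegrableOn (fun x => |f' x|) (Set.Ioo (-1) 1) :=
    (hf'int.mono_set Set.Ioo_subset_Icc_self).abs
  have hdiv : IntegrableOn (fun x => |f' x| / (1 - |x|)) (Set.Ioo (-1) 1) := by
    refine IntegrableOn.congr_fun hL1.abs (fun x hx => ?_) measurableSet_Ioo
    have : |x| < 1 := abs_lt.2 hx
    simp only [abs_div]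
    rw [abs_of_pos (sub_pos.2 this)]
  have absl : ∀ u ∈ Set.Ioo (0 : ℝ) 1, 1 - |u - 1| = u := fun u hu => by
    rw [abs_of_nonpos (by linarith [hu.2])]; ring
  have absr : ∀ u ∈ Set.Ioo (0 : ℝ) 1, 1 - |1 - u| = u := fun u hu => by
    rw [abs_of_nonneg (by linarith [hu.2])]; ring
  have hii : ∀ a b : ℝ, a ∈ Set.Icc (-1 : ℝ) 1 → b ∈ Set.Icc (-1 : ℝ) 1 →
      IntervalIntegrable f' volume a b := fun a b ha hb =>
    (hf'int.mono_set (Set.uIcc_subset_Icc ha hb)).intervalIntegrable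
  obtain ⟨hil, hir, hie⟩ := integral_Ioo_fold hint
  obtain ⟨hdl, hdr, hde⟩ := integral_Ioo_fold hdiv
  have left := two_mul_integral_div_le (F := fun u => |f (u - 1)|) (h := fun u => |f' (u - 1)|)
    (fun _ _ => abs_nonneg _)
    (fun u hu => by
      rw [hf _ ⟨by linarith [hu.1], by linarith [hu.2]⟩, ← integral_Ioc_eq_integral_Ioo,
        ← intervalIntegral.integral_of_le hu.1.le,
        intervalIntegral.integral_comp_sub_right (fun x => |f' x|), zero_sub]
      exact intervalIntegral.abs_integral_le_integral_abs (by linarith [hu.1]))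
    (fun _ => abs_nonneg _) hil
    (hdl.congr_fun (fun u hu => by simp only [absl u hu]) measurableSet_Ioo)
  have right := two_mul_integral_div_le (F := fun u => |f (1 - u)|) (h := fun u => |f' (1 - u)|)
    (fun _ _ => abs_nonneg _)
    (fun u hu => by
      have m : 1 - u ∈ Set.Icc (-1 : ℝ) 1 := ⟨by linarith [hu.2], by linarith [hu.1]⟩
      have e : f (1 - u) = -∫ t in (1 - u)..1, f' t := by
        have := intervalIntegral.integral_add_adjacent_intervals
          (hii (-1) (1 - u) (by norm_num) m) (hii (1 - u) 1 m (by norm_num))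
        rw [← hf _ m, ← hf 1 (by norm_num), hfb] at this
        linarith
      rw [e, abs_neg, ← integral_Ioc_eq_integral_Ioo,
        ← intervalIntegral.integral_of_le hu.1.le,
        intervalIntegral.integral_comp_sub_left (fun x => |f' x|), sub_zero]
      exact intervalIntegral.abs_integral_le_integral_abs (by linarith [hu.1]))
    (fun _ => abs_nonneg _) hir
    (hdr.congr_fun (fun u hu => by simp only [absr u hu]) measurableSet_Ioo)
  have cl : ∀ g : ℝ → ℝ, ∫ u in Set.Ioo (0 : ℝ) 1, |g (u - 1)| / (1 - |u - 1|) =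
      ∫ u in Set.Ioo (0 : ℝ) 1, |g (u - 1)| / u := fun g =>
    setIntegral_congr_fun measurableSet_Ioo fun u hu => by simp only [absl u hu]
  have cr : ∀ g : ℝ → ℝ, ∫ u in Set.Ioo (0 : ℝ) 1, |g (1 - u)| / (1 - |1 - u|) =
      ∫ u in Set.Ioo (0 : ℝ) 1, |g (1 - u)| / u := fun g =>
    setIntegral_congr_fun measurableSet_Ioo fun u hu => by simp only [absr u hu]
  have nl : 0 ≤ ∫ u in Set.Ioo (0 : ℝ) 1, |f (u - 1)| / u :=
    setIntegral_nonneg measurableSet_Ioo fun u hu => div_nonneg (abs_nonneg _) hu.1.le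
  have nr : 0 ≤ ∫ u in Set.Ioo (0 : ℝ) 1, |f (1 - u)| / u :=
    setIntegral_nonneg measurableSet_Ioo fun u hu => div_nonneg (abs_nonneg _) hu.1.le
  rw [hie, hde, cl f', cr f']
  by_cases hfi : IntegrableOn (fun x => |f x| / (1 - |x|)) (Set.Ioo (-1) 1)
  · rw [(integral_Ioo_fold hfi).2.2, cl f, cr f]
    have := mul_le_mul_of_nonneg_right hj2 (add_nonneg nl nr)
    linarith
  · rw [integral_undef hfi, mul_zero]
    linarith
end

section
/- Let f be absolutely continuous on [−1, 1] with f(−1) = f(1) = 0 and f′(x)/(1 − |x|) ∈ L¹[−1, 1]. Then ∫₋₁¹ |f(x)|/(1 − |x|)² dx ≤ ∫₋₁¹ |f′(x)|/(1 − |x|) dx − ∫₋₁¹ |f′(x)| dx. -/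
open MeasureTheory Real Set Filter

/-- The weight `(1 - |x|)⁻²` has mass `|t| / (1 - |t|)` between `0` and `t`. -/
lemma lintegral_uIoc_inv_one_sub_abs_sq {t : ℝ} (ht : t ∈ Ioo (-1 : ℝ) 1) :
    ∫⁻ x in uIoc 0 t, ENNReal.ofReal (1 / (1 - |x|) ^ 2)
      = ENNReal.ofReal (|t| / (1 - |t|)) := by
  have habs : ∀ x ∈ uIcc 0 t, 1 - |x| ≠ 0 := by
    intro x hx
    have h1 : |x| ≤ |t| := by simpa using abs_sub_left_of_mem_uIcc hx
    have h2 : |t| < 1 := abs_lt.2 ht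
    linarith
  have hcont : ContinuousOn (fun x : ℝ => 1 / (1 - |x|) ^ 2) (uIcc 0 t) :=
    continuousOn_const.div (by fun_prop) fun x hx => pow_ne_zero 2 (habs x hx)
  have hint : IntegrableOn (fun x : ℝ => 1 / (1 - |x|) ^ 2) (uIoc 0 t) :=
    intervalIntegrable_iff.1 hcont.intervalIntegrable
  rw [← ofReal_integral_eq_lintegral_ofReal hint (ae_of_all _ fun x => by positivity)]
  congr 1
  rcases le_total 0 t with h0 | h0
  · rw [uIoc_of_le h0, ← intervalIntegral.integral_of_le h0,
      intervalIntegral.integral_eq_sub_of_hasDerivAt_of_le h0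
        (f := fun x => x / (1 - |x|)) (by
          rw [← uIcc_of_le h0]; exact continuousOn_id.div (by fun_prop) habs) ?_
        hcont.intervalIntegrable]
    · simp [abs_of_nonneg h0]
    · intro x hx
      have hne : 1 - x ≠ 0 := by linarith [hx.2, ht.2]
      have h := (hasDerivAt_id x).div ((hasDerivAt_id x).const_sub 1) hne
      rw [abs_of_pos hx.1]
      refine (h.congr_deriv (by simp)).congr_of_eventuallyEq ?_
      filter_upwards [lt_mem_nhds hx.1] with y hy
      simp [abs_of_pos hy]
  · rw [uIoc_of_ge h0, ← intervalIntegral.integral_of_le h0,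
      intervalIntegral.integral_eq_sub_of_hasDerivAt_of_le h0
        (f := fun x => x / (1 - |x|)) (by
          rw [← uIcc_of_ge h0]; exact continuousOn_id.div (by fun_prop) habs) ?_
        hcont.intervalIntegrable.symm]
    · simp [abs_of_nonpos h0, neg_div]
    · intro x hx
      have hne : 1 + x ≠ 0 := by linarith [hx.1, ht.1]
      have h := (hasDerivAt_id x).div ((hasDerivAt_id x).const_add 1) hne
      rw [abs_of_neg hx.2]
      refine (h.congr_deriv (by simp)).congr_of_eventuallyEq ?_
      filter_upwards [gt_mem_nhds hx.2] with y hy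
      simp [abs_of_neg hy]

/-- A primitive vanishing at `±1` is bounded at `x` by the mass of its derivative on the part of
`(-1, 1)` lying beyond `x` as seen from `0`. -/
lemma enorm_le_lintegral_of_primitive {f f' : ℝ → ℝ}
    (hf'int : IntegrableOn f' (Icc (-1) 1))
    (hf : ∀ x ∈ Icc (-1 : ℝ) 1, f x = ∫ t in (-1 : ℝ)..x, f' t)
    (hfb : f 1 = 0) {x : ℝ} (hx : x ∈ Ioo (-1 : ℝ) 1) :
    ‖f x‖ₑ ≤ ∫⁻ t in Ioo (-1 : ℝ) 1 ∩ {t | x ∈ uIoc 0 t}, ‖f' t‖ₑ := by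
  have hfx := hf x ⟨hx.1.le, hx.2.le⟩
  rcases le_or_gt x 0 with h0 | h0
  · rw [hfx, intervalIntegral.integral_of_le hx.1.le, integral_Ioc_eq_integral_Ioo]
    refine (enorm_integral_le_lintegral_enorm _).trans (lintegral_mono_set ?_)
    intro t ht
    exact ⟨⟨ht.1, ht.2.trans hx.2⟩, mem_uIoc.2 (Or.inr ⟨ht.2, h0⟩)⟩
  · have hii : ∀ a ∈ Icc (-1 : ℝ) 1, ∀ b ∈ Icc (-1 : ℝ) 1,
        IntervalIntegrable f' volume a b := fun a ha b hb =>
      (hf'int.mono_set (uIcc_subset_Icc ha hb)).intervalIntegrable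
    have hxm : x ∈ Icc (-1 : ℝ) 1 := ⟨hx.1.le, hx.2.le⟩
    have hadd := intervalIntegral.integral_add_adjacent_intervals
      (hii (-1) (by simp) x hxm) (hii x hxm 1 (by simp))
    rw [← hf 1 (by simp), hfb, ← hfx] at hadd
    rw [eq_neg_of_add_eq_zero_left hadd, enorm_neg, intervalIntegral.integral_of_le hx.2.le,
      integral_Ioc_eq_integral_Ioo]
    refine (enorm_integral_le_lintegral_enorm _).trans (lintegral_mono_set ?_)
    intro t ht
    exact ⟨⟨hx.1.trans ht.1, ht.2⟩, mem_uIoc.2 (Or.inl ⟨h0, ht.1.le⟩)⟩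

/-- The weighted Hardy inequality in terms of lower Lebesgue integrals. -/
lemma lintegral_hardy_one_sub_abs {f f' : ℝ → ℝ}
    (hf'int : IntegrableOn f' (Icc (-1) 1))
    (hf : ∀ x ∈ Icc (-1 : ℝ) 1, f x = ∫ t in (-1 : ℝ)..x, f' t)
    (hfb : f 1 = 0) :
    ∫⁻ x in Ioo (-1 : ℝ) 1, ENNReal.ofReal (|f x| / (1 - |x|) ^ 2)
      ≤ ∫⁻ t in Ioo (-1 : ℝ) 1, ENNReal.ofReal (|f' t| / (1 - |t|) - |f' t|) := by
  set w : ℝ → ENNReal := fun x => ENNReal.ofReal (1 / (1 - |x|) ^ 2) with hw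
  have hwm : Measurable w := by fun_prop
  set S : Set (ℝ × ℝ) := {p | p.1 ∈ uIoc 0 p.2} with hS
  have hSm : MeasurableSet S := by
    have : S = {p : ℝ × ℝ | 0 < p.1 ∧ p.1 ≤ p.2 ∨ p.2 < p.1 ∧ p.1 ≤ 0} := by
      ext p; exact mem_uIoc
    rw [this]
    measurability
  have hgm : AEMeasurable (fun t => ‖f' t‖ₑ) (volume.restrict (Ioo (-1 : ℝ) 1)) :=
    (hf'int.mono_set Ioo_subset_Icc_self).aestronglyMeasurable.enorm
  have hKm : AEMeasurable (S.indicator fun p => w p.1 * ‖f' p.2‖ₑ)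
      ((volume.restrict (Ioo (-1 : ℝ) 1)).prod (volume.restrict (Ioo (-1 : ℝ) 1))) :=
    ((hwm.comp measurable_fst).aemeasurable.mul hgm.comp_snd).indicator hSm
  calc ∫⁻ x in Ioo (-1 : ℝ) 1, ENNReal.ofReal (|f x| / (1 - |x|) ^ 2)
      ≤ ∫⁻ x in Ioo (-1 : ℝ) 1, ∫⁻ t in Ioo (-1 : ℝ) 1,
          S.indicator (fun p => w p.1 * ‖f' p.2‖ₑ) (x, t) := by
        refine setLIntegral_mono' measurableSet_Ioo fun x hx => ?_
        have hTm : MeasurableSet {t : ℝ | x ∈ uIoc 0 t} := measurable_prodMk_left hSm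
        have hK : ∀ t, S.indicator (fun p => w p.1 * ‖f' p.2‖ₑ) (x, t)
            = {t : ℝ | x ∈ uIoc 0 t}.indicator (fun t => w x * ‖f' t‖ₑ) t := fun t => rfl
        simp_rw [hK]
        rw [lintegral_indicator hTm, Measure.restrict_restrict hTm, inter_comm,
          lintegral_const_mul' _ _ ENNReal.ofReal_ne_top, div_eq_mul_one_div, mul_comm,
          ENNReal.ofReal_mul (by positivity), ← Real.norm_eq_abs (f x), ofReal_norm]
        gcongr
        exact enorm_le_lintegral_of_primitive hf'int hf hfb hx
    _ = ∫⁻ t in Ioo (-1 : ℝ) 1, ∫⁻ x in Ioo (-1 : ℝ) 1,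
          S.indicator (fun p => w p.1 * ‖f' p.2‖ₑ) (x, t) := lintegral_lintegral_swap hKm
    _ ≤ _ := by
        refine setLIntegral_mono' measurableSet_Ioo fun t ht => ?_
        have hK : ∀ x, S.indicator (fun p => w p.1 * ‖f' p.2‖ₑ) (x, t)
            = (uIoc 0 t).indicator (fun x => w x * ‖f' t‖ₑ) x := fun x => rfl
        simp_rw [hK]
        have hpos : 0 < 1 - |t| := sub_pos.2 (abs_lt.2 ht)
        refine (setLIntegral_le_lintegral _ _).trans ?_
        rw [lintegral_indicator measurableSet_uIoc, lintegral_mul_const _ hwm,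
          lintegral_uIoc_inv_one_sub_abs_sq ht, ← ofReal_norm, Real.norm_eq_abs,
          ← ENNReal.ofReal_mul (by positivity)]
        refine ENNReal.ofReal_le_ofReal (le_of_eq ?_)
        field_simp
        ring

theorem stmt_9 (f f' : ℝ → ℝ)
    (hf'int : IntegrableOn f' (Set.Icc (-1) 1))
    (hf : ∀ x ∈ Set.Icc (-1:ℝ) 1, f x = ∫ t in (-1:ℝ)..x, f' t)
    (hfb : f 1 = 0)
    (hL1 : IntegrableOn (fun x => f' x / (1 - |x|)) (Set.Ioo (-1) 1)) :
    (∫ x in Set.Ioo (-1:ℝ) 1, |f x| / (1 - |x|) ^ 2)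
      ≤ (∫ x in Set.Ioo (-1:ℝ) 1, |f' x| / (1 - |x|))
        - ∫ x in Set.Ioo (-1:ℝ) 1, |f' x| := by
  have hpos : ∀ x ∈ Ioo (-1 : ℝ) 1, 0 < 1 - |x| := fun x hx => sub_pos.2 (abs_lt.2 hx)
  have h1 : IntegrableOn (fun x => |f' x| / (1 - |x|)) (Ioo (-1) 1) := by
    refine IntegrableOn.congr_fun hL1.abs (fun x hx => ?_) measurableSet_Ioo
    simp only [abs_div, abs_of_pos (hpos x hx)]
  have h2 : IntegrableOn (fun x => |f' x|) (Ioo (-1) 1) :=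
    (hf'int.mono_set Ioo_subset_Icc_self).abs
  have hnonneg : 0 ≤ᵐ[volume.restrict (Ioo (-1 : ℝ) 1)]
      fun x => |f' x| / (1 - |x|) - |f' x| := by
    filter_upwards [ae_restrict_mem measurableSet_Ioo] with x hx
    exact sub_nonneg.2 (le_div_self (abs_nonneg _) (hpos x hx) (by linarith [abs_nonneg x]))
  rw [← integral_sub h1 h2]
  by_cases h : IntegrableOn (fun x => |f x| / (1 - |x|) ^ 2) (Ioo (-1) 1)
  · rw [← ENNReal.ofReal_le_ofReal_iff (integral_nonneg_of_ae hnonneg),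
      ofReal_integral_eq_lintegral_ofReal h (ae_of_all _ fun x => by positivity),
      ofReal_integral_eq_lintegral_ofReal
        (f := fun x => |f' x| / (1 - |x|) - |f' x|) (h1.sub h2) hnonneg]
    exact lintegral_hardy_one_sub_abs hf'int hf hfb
  · rw [integral_undef h]
    exact integral_nonneg_of_ae hnonneg
end

section
/- Let m > 1, ν ∈ [0, 1/m], λ ∈ [0, (1 + νm)/2), and let c > 0 satisfy (1 − 2λ)·J_ν(2c/m) + 2c·J′_ν(2c/m) = 0 with 2c/m ∈ (0, j_ν). Let a < b and let g be a continuously differentiable function on [a, b] with g(a) = g(b) = 0. Then ((1 − ν²m²)/4)·∫ₐᵇ |g(x)|²/δ(x)² dx + ((c² + (m − 1)(λ − λ²))/δ₀^m)·∫ₐᵇ |g(x)|²/δ(x)^{2−m} dx ≤ 4·((1 + νm)/2 − λ²)·∫ₐᵇ |g′(x)|² dx. -/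
open MeasureTheory Real Set Filter

/-- The entire function `∑ (-1)ᵏ sᵏ / (k! Γ(k+1+α))`, so that
`J_α(x) = (x/2)^α * besselEntire α (x²/4)`. -/
noncomputable def besselEntire (α s : ℝ) : ℝ :=
  ∑' k : ℕ, (-1 : ℝ) ^ k / ((Nat.factorial k : ℝ) * Real.Gamma ((k : ℝ) + 1 + α)) * s ^ k

theorem Gamma_one_add_le_Gamma_nat_add {α : ℝ} (hα : 0 ≤ α) (k : ℕ) :
    Real.Gamma (1 + α) ≤ Real.Gamma ((k : ℝ) + 1 + α) := by
  induction k with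
  | zero => simp
  | succ k ih =>
    have h : Real.Gamma (((k + 1 : ℕ) : ℝ) + 1 + α)
        = ((k : ℝ) + 1 + α) * Real.Gamma ((k : ℝ) + 1 + α) := by
      rw [← Real.Gamma_add_one (by positivity)]
      push_cast
      ring_nf
    have hpos : 0 < Real.Gamma ((k : ℝ) + 1 + α) := Real.Gamma_pos_of_pos (by positivity)
    rw [h]
    nlinarith [mul_nonneg (by positivity : (0 : ℝ) ≤ k + α) hpos.le]

theorem abs_besselEntire_coeff_le {α : ℝ} (hα : 0 ≤ α) (k : ℕ) :
    |(-1 : ℝ) ^ k / ((Nat.factorial k : ℝ) * Real.Gamma ((k : ℝ) + 1 + α))|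
      ≤ 1 / (Nat.factorial k : ℝ) * (1 / Real.Gamma (1 + α)) := by
  have h1 : 0 < Real.Gamma (1 + α) := Real.Gamma_pos_of_pos (by positivity)
  have hk : 0 < Real.Gamma ((k : ℝ) + 1 + α) := Real.Gamma_pos_of_pos (by positivity)
  rw [abs_div, abs_pow, abs_neg, abs_one, one_pow, abs_of_pos (by positivity),
    one_div_mul_one_div]
  gcongr
  exact Gamma_one_add_le_Gamma_nat_add hα k

theorem summable_besselEntire {α : ℝ} (hα : 0 ≤ α) (s : ℝ) :
    Summable fun k : ℕ =>
      (-1 : ℝ) ^ k / ((Nat.factorial k : ℝ) * Real.Gamma ((k : ℝ) + 1 + α)) * s ^ k := by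
  refine Summable.of_norm_bounded
    ((Real.summable_pow_div_factorial |s|).mul_right (1 / Real.Gamma (1 + α))) fun k => ?_
  rw [Real.norm_eq_abs, abs_mul, abs_pow]
  calc _ ≤ 1 / (Nat.factorial k : ℝ) * (1 / Real.Gamma (1 + α)) * |s| ^ k := by
        gcongr
        exact abs_besselEntire_coeff_le hα k
    _ = _ := by ring

theorem besselEntire_deriv_coeff (α s : ℝ) (k : ℕ) :
    (-1 : ℝ) ^ (k + 1) / ((Nat.factorial (k + 1) : ℝ) * Real.Gamma (((k + 1 : ℕ) : ℝ) + 1 + α))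
        * (((k + 1 : ℕ) : ℝ) * s ^ k)
      = -((-1 : ℝ) ^ k / ((Nat.factorial k : ℝ) * Real.Gamma ((k : ℝ) + 1 + (α + 1))) * s ^ k) := by
  have h : ((k + 1 : ℕ) : ℝ) + 1 + α = (k : ℝ) + 1 + (α + 1) := by push_cast; ring
  have hk : ((k + 1 : ℕ) : ℝ) ≠ 0 := by positivity
  rw [h, Nat.factorial_succ, Nat.cast_mul, pow_succ]
  field_simp

theorem hasDerivAt_besselEntire {α : ℝ} (hα : 0 ≤ α) (s : ℝ) :
    HasDerivAt (besselEntire α) (-besselEntire (α + 1) s) s := by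
  set R : ℝ := |s| + 1
  have hu : Summable fun k : ℕ =>
      1 / (Nat.factorial k : ℝ) * (1 / Real.Gamma (1 + α)) * ((k : ℝ) * R ^ (k - 1)) := by
    rw [← summable_nat_add_iff 1]
    refine ((Real.summable_pow_div_factorial R).mul_right (1 / Real.Gamma (1 + α))).congr
      fun k => ?_
    have hk : ((k + 1 : ℕ) : ℝ) ≠ 0 := by positivity
    rw [Nat.factorial_succ, Nat.cast_mul, Nat.add_sub_cancel]
    field_simp
  have hs : s ∈ Metric.ball (0 : ℝ) R := by simp [R]
  have key := hasDerivAt_tsum_of_isPreconnected (𝕜 := ℝ) (t := Metric.ball (0 : ℝ) R)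
    (g := fun (k : ℕ) (y : ℝ) =>
      (-1 : ℝ) ^ k / ((Nat.factorial k : ℝ) * Real.Gamma ((k : ℝ) + 1 + α)) * y ^ k)
    (g' := fun (k : ℕ) (y : ℝ) =>
      (-1 : ℝ) ^ k / ((Nat.factorial k : ℝ) * Real.Gamma ((k : ℝ) + 1 + α))
        * ((k : ℝ) * y ^ (k - 1)))
    hu Metric.isOpen_ball (convex_ball _ _).isPreconnected
    (fun k y _ => (hasDerivAt_pow k y).const_mul _)
    (fun k y hy => by
      have hy' : |y| ≤ R := by simpa using (mem_ball_zero_iff.mp hy).le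
      rw [Real.norm_eq_abs, abs_mul, abs_mul, abs_pow, Nat.abs_cast]
      gcongr
      exact abs_besselEntire_coeff_le hα k)
    hs (summable_besselEntire hα s) hs
  refine HasDerivAt.congr_deriv key ?_
  have hsum : Summable fun k : ℕ =>
      (-1 : ℝ) ^ k / ((Nat.factorial k : ℝ) * Real.Gamma ((k : ℝ) + 1 + α))
        * ((k : ℝ) * s ^ (k - 1)) := by
    rw [← summable_nat_add_iff 1]
    simp only [Nat.add_sub_cancel, besselEntire_deriv_coeff]
    exact (summable_besselEntire (by linarith) s).neg
  rw [hsum.tsum_eq_zero_add]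
  simp only [Nat.add_sub_cancel, besselEntire_deriv_coeff, Nat.cast_zero, zero_mul, mul_zero,
    zero_add, tsum_neg]
  rfl

theorem besselEntire_recurrence {α : ℝ} (hα : 0 ≤ α) (s : ℝ) :
    (α + 1) * besselEntire (α + 1) s - s * besselEntire (α + 1 + 1) s = besselEntire α s := by
  have hα1 : 0 ≤ α + 1 := by linarith
  have hsum : Summable fun k : ℕ => (k : ℝ) *
      ((-1 : ℝ) ^ k / ((Nat.factorial k : ℝ) * Real.Gamma ((k : ℝ) + 1 + (α + 1))) * s ^ k) := by
    rw [← summable_nat_add_iff 1]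
    refine ((summable_besselEntire (by linarith : 0 ≤ α + 1 + 1) s).mul_left (-s)).congr
      fun k => ?_
    linear_combination (-s) * besselEntire_deriv_coeff (α + 1) s k
  have h2 : -(s * besselEntire (α + 1 + 1) s) = ∑' k : ℕ, (k : ℝ) *
      ((-1 : ℝ) ^ k / ((Nat.factorial k : ℝ) * Real.Gamma ((k : ℝ) + 1 + (α + 1))) * s ^ k) := by
    rw [hsum.tsum_eq_zero_add, besselEntire, ← neg_mul, ← tsum_mul_left, Nat.cast_zero,
      zero_mul, zero_add]
    refine tsum_congr fun k => ?_
    linear_combination (-s) * besselEntire_deriv_coeff (α + 1) s k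
  rw [sub_eq_add_neg, h2, besselEntire, besselEntire, ← tsum_mul_left,
    ← ((summable_besselEntire hα1 s).mul_left _).tsum_add hsum]
  refine tsum_congr fun k => ?_
  have hk : (k : ℝ) + 1 + α ≠ 0 := by positivity
  have hΓ : Real.Gamma ((k : ℝ) + 1 + (α + 1))
      = ((k : ℝ) + 1 + α) * Real.Gamma ((k : ℝ) + 1 + α) := by
    rw [← Real.Gamma_add_one hk]
    ring_nf
  have hpos : Real.Gamma ((k : ℝ) + 1 + α) ≠ 0 := (Real.Gamma_pos_of_pos (by positivity)).ne'
  rw [hΓ]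
  field_simp
  ring

theorem besselEntire_add_one_pos {α r : ℝ} (hα : 0 ≤ α)
    (h : ∀ s ∈ Ioo 0 r, 0 < besselEntire α s) :
    ∀ s ∈ Ioo 0 r, 0 < besselEntire (α + 1) s := by
  intro s hs
  have hα1 : 0 ≤ α + 1 := by linarith
  have hd : ∀ t, 0 < t → HasDerivAt (fun t => t ^ (α + 1) * besselEntire (α + 1) t)
      (t ^ α * besselEntire α t) t := by
    intro t ht
    have h1 := (Real.hasDerivAt_rpow_const (p := α + 1) (Or.inl ht.ne')).mul
      (hasDerivAt_besselEntire hα1 t)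
    refine h1.congr_deriv ?_
    rw [← besselEntire_recurrence hα t, Real.rpow_add_one ht.ne', add_sub_cancel_right]
    ring
  have hmono : StrictMonoOn (fun t => t ^ (α + 1) * besselEntire (α + 1) t) (Icc 0 s) := by
    apply strictMonoOn_of_deriv_pos (convex_Icc 0 s)
    · intro t _
      exact ((Real.continuousAt_rpow_const t (α + 1) (Or.inr (by linarith))).mul
        (hasDerivAt_besselEntire hα1 t).continuousAt).continuousWithinAt
    · intro t ht
      rw [interior_Icc] at ht
      rw [(hd t ht.1).deriv]
      exact mul_pos (Real.rpow_pos_of_pos ht.1 _) (h t ⟨ht.1, ht.2.trans hs.2⟩)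
  have h0 := hmono (left_mem_Icc.2 hs.1.le) (right_mem_Icc.2 hs.1.le) hs.1
  simp only [Real.zero_rpow (by linarith : α + 1 ≠ 0), zero_mul] at h0
  exact pos_of_mul_pos_right h0 (Real.rpow_nonneg hs.1.le _)

theorem besselJ_eq_rpow_mul_besselEntire (ν : ℝ) {x : ℝ} (hx : 0 < x) :
    besselJ ν x = (x / 2) ^ ν * besselEntire ν (x ^ 2 / 4) := by
  rw [besselJ, besselEntire, ← tsum_mul_left]
  refine tsum_congr fun k => ?_
  have h (y : ℝ) (hy : 0 < y) : y ^ (2 * (k : ℝ) + ν) = (y ^ 2) ^ k * y ^ ν := by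
    rw [Real.rpow_add hy, ← pow_mul]
    congr 1
    exact_mod_cast Real.rpow_natCast y (2 * k)
  rw [h x hx, h 2 two_pos, Real.div_rpow hx.le two_pos.le, div_pow]
  norm_num
  have : (2 : ℝ) ^ ν ≠ 0 := (Real.rpow_pos_of_pos two_pos ν).ne'
  field_simp

theorem mul_deriv_besselJ {ν x : ℝ} (hν : 0 ≤ ν) (hx : 0 < x) :
    x * deriv (besselJ ν) x = (x / 2) ^ ν *
      (ν * besselEntire ν (x ^ 2 / 4) - x ^ 2 / 2 * besselEntire (ν + 1) (x ^ 2 / 4)) := by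
  have h1 : HasDerivAt (fun y : ℝ => (y / 2) ^ ν) (1 / 2 * ν * (x / 2) ^ (ν - 1)) x :=
    ((hasDerivAt_id x).div_const 2).rpow_const (Or.inl (by positivity))
  have h2 : HasDerivAt (fun y : ℝ => besselEntire ν (y ^ 2 / 4))
      (-besselEntire (ν + 1) (x ^ 2 / 4) * (((2 : ℕ) : ℝ) * x ^ (2 - 1) / 4)) x :=
    (hasDerivAt_besselEntire hν _).comp x ((hasDerivAt_pow 2 x).div_const 4)
  have heq : besselJ ν =ᶠ[nhds x] fun y => (y / 2) ^ ν * besselEntire ν (y ^ 2 / 4) := by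
    filter_upwards [lt_mem_nhds hx] with y hy
    exact besselJ_eq_rpow_mul_besselEntire ν hy
  rw [((h1.mul h2).congr_of_eventuallyEq heq).deriv, Real.rpow_sub_one (by positivity)]
  push_cast
  field_simp
  ring

/-- Rayleigh-type upper bound for the root `c` of the Robin condition
`(1 - 2λ) J_ν(2c/m) + 2c J_ν'(2c/m) = 0` lying below the first zero of `J_ν`. -/
theorem sq_le_of_besselJ_robin {m ν lam c j : ℝ} (hm : 0 < m) (hν : 0 ≤ ν) (hc : 0 < c)
    (hpos : ∀ t ∈ Ioo 0 j, 0 < besselJ ν t) (hcm : 2 * c / m ∈ Ioo 0 j)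
    (hroot : (1 - 2 * lam) * besselJ ν (2 * c / m)
      + 2 * c * deriv (besselJ ν) (2 * c / m) = 0) :
    c ^ 2 ≤ ((1 + ν * m) / 2 - lam) * (m * (ν + 1)) := by
  obtain ⟨hz, hzj⟩ := hcm
  set z := 2 * c / m with hzdef
  have hcz : 2 * c = m * z := by rw [hzdef]; field_simp
  have hj : 0 < j := hz.trans hzj
  have hu : ∀ s ∈ Ioo 0 (j ^ 2 / 4), 0 < besselEntire ν s := by
    intro s hs
    have ht : 0 < 2 * √s := by have := Real.sqrt_pos.2 hs.1; positivity
    have hsq : (2 * √s) ^ 2 / 4 = s := by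
      rw [mul_pow, Real.sq_sqrt hs.1.le]; ring
    have h1 := hpos (2 * √s) ⟨ht, by
      refine lt_of_pow_lt_pow_left₀ 2 hj.le ?_
      linarith [hs.2]⟩
    rw [besselJ_eq_rpow_mul_besselEntire ν ht, hsq] at h1
    exact pos_of_mul_pos_right h1 (Real.rpow_nonneg (by positivity) _)
  have hs : z ^ 2 / 4 ∈ Ioo 0 (j ^ 2 / 4) := ⟨by positivity, by gcongr⟩
  have hw := besselEntire_add_one_pos hν hu
  have hw2 := besselEntire_add_one_pos (by linarith : 0 ≤ ν + 1) hw
  have hrec := besselEntire_recurrence hν (z ^ 2 / 4)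
  have hu0 := hu _ hs
  have hw20 := hw2 _ hs
  rw [hcz, mul_assoc, mul_deriv_besselJ hν hz, besselJ_eq_rpow_mul_besselEntire ν hz] at hroot
  set u := besselEntire ν (z ^ 2 / 4)
  set w := besselEntire (ν + 1) (z ^ 2 / 4)
  have hroot' : (z / 2) ^ ν * (((1 + ν * m) / 2 - lam) * u - m * (z ^ 2 / 4) * w) = 0 := by
    linear_combination hroot / 2
  have hE : ((1 + ν * m) / 2 - lam) * u = m * (z ^ 2 / 4) * w := by
    rcases mul_eq_zero.1 hroot' with h | h
    · exact absurd h (Real.rpow_pos_of_pos (by positivity) _).ne'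
    · linarith
  have hle : u ≤ (ν + 1) * w := by
    have := mul_pos hs.1 hw20
    linarith
  have hc2 : c ^ 2 = m * (m * (z ^ 2 / 4)) := by
    have : c = m * z / 2 := by linarith
    rw [this]; ring
  refine le_of_mul_le_mul_right ?_ hu0
  calc c ^ 2 * u ≤ c ^ 2 * ((ν + 1) * w) := by gcongr
    _ = ((1 + ν * m) / 2 - lam) * (m * (ν + 1)) * u := by
      rw [hc2]
      linear_combination (-(m * (ν + 1))) * hE

theorem hardy_quadratic_le {m P R K τ q p : ℝ} (hK : 0 ≤ K) (hP : P ≤ K / 4)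
    (hPR : P + R ≤ K * m / 2) (hτ0 : 0 ≤ τ) (hτ1 : τ ≤ 1) :
    K * ((1 - τ) * q * p - q ^ 2 / 2 * (1 + (m - 1) * τ))
      ≤ K * p ^ 2 - P * q ^ 2 - R * τ * q ^ 2 := by
  have h1 : 0 ≤ K * (p - (1 - τ) * q / 2) ^ 2 := by positivity
  have h2 : P + R * τ ≤ K * (1 / 4 + m * τ / 2 - τ ^ 2 / 4) := by
    nlinarith [mul_nonneg (sub_nonneg.2 hPR) hτ0,
      mul_nonneg (sub_nonneg.2 hP) (sub_nonneg.2 hτ1),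
      mul_nonneg hK (mul_nonneg hτ0 (sub_nonneg.2 hτ1))]
  nlinarith [mul_nonneg (sub_nonneg.2 h2) (sq_nonneg q)]

/-- Improved Hardy inequality on `(0, d)` for functions vanishing at `0`, together with the
integrability of both weighted terms. -/
theorem hardy_half_interval {d m P R K : ℝ} {h h' : ℝ → ℝ} (hd : 0 < d) (hm : 1 < m)
    (hK : 0 ≤ K) (hP : P ≤ K / 4) (hPR : P + R ≤ K * m / 2)
    (hh : ∀ t ∈ Icc 0 d, HasDerivAt h (h' t) t) (hh' : ContinuousOn h' (Icc 0 d))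
    (h0 : h 0 = 0) :
    IntervalIntegrable (fun t => |h t| ^ 2 / t ^ 2) volume 0 d ∧
    IntervalIntegrable (fun t => |h t| ^ 2 / t ^ ((2 : ℝ) - m)) volume 0 d ∧
    P * (∫ t in (0 : ℝ)..d, |h t| ^ 2 / t ^ 2)
      + R / d ^ m * (∫ t in (0 : ℝ)..d, |h t| ^ 2 / t ^ ((2 : ℝ) - m))
      ≤ K * ∫ t in (0 : ℝ)..d, |h' t| ^ 2 := by
  simp only [sq_abs]
  obtain ⟨M, hM⟩ := isCompact_Icc.exists_bound_of_continuousOn hh'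
  have hcont : ContinuousOn h (Icc 0 d) := fun t ht => (hh t ht).continuousAt.continuousWithinAt
  have hlip : ∀ t ∈ Icc 0 d, |h t| ≤ M * t := by
    intro t ht
    simpa [h0] using norm_image_sub_le_of_norm_deriv_le_segment'
      (fun x hx => (hh x hx).hasDerivWithinAt) (fun x hx => hM x (Ico_subset_Icc_self hx)) t ht
  have hsq : ∀ t ∈ Icc 0 d, h t ^ 2 ≤ M ^ 2 * t ^ 2 := by
    intro t ht
    rw [← sq_abs (h t), ← mul_pow]
    exact pow_le_pow_left₀ (abs_nonneg _) (hlip t ht) 2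
  have hpow : ∀ t : ℝ, 0 < t → t ^ ((2 : ℝ) - m) = t ^ 2 / t ^ m := by
    intro t ht
    rw [Real.rpow_sub ht, Real.rpow_two]
  have hdm : 0 < d ^ m := Real.rpow_pos_of_pos hd m
  have int1 : IntervalIntegrable (fun t => h t ^ 2 / t ^ 2) volume 0 d := by
    rw [intervalIntegrable_iff_integrableOn_Ioc_of_le hd.le]
    refine ⟨ContinuousOn.aestronglyMeasurable ?_ measurableSet_Ioc,
      .restrict_of_bounded (C := M ^ 2) (by simp) ?_⟩
    · exact ((hcont.mono Ioc_subset_Icc_self).pow 2).div (by fun_prop)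
        fun t ht => (pow_pos ht.1 2).ne'
    · refine (ae_restrict_iff' measurableSet_Ioc).2 (Eventually.of_forall fun t ht => ?_)
      rw [Real.norm_of_nonneg (by positivity), div_le_iff₀ (pow_pos ht.1 2)]
      exact hsq t (Ioc_subset_Icc_self ht)
  have int2 : IntervalIntegrable (fun t => h t ^ 2 / t ^ ((2 : ℝ) - m)) volume 0 d := by
    rw [intervalIntegrable_iff_integrableOn_Ioc_of_le hd.le]
    refine ⟨ContinuousOn.aestronglyMeasurable ?_ measurableSet_Ioc,
      .restrict_of_bounded (C := M ^ 2 * d ^ m) (by simp) ?_⟩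
    · exact ((hcont.mono Ioc_subset_Icc_self).pow 2).div
        (fun t ht => (Real.continuousAt_rpow_const t _ (Or.inl ht.1.ne')).continuousWithinAt)
        fun t ht => (Real.rpow_pos_of_pos ht.1 _).ne'
    · refine (ae_restrict_iff' measurableSet_Ioc).2 (Eventually.of_forall fun t ht => ?_)
      have htm : 0 < t ^ m := Real.rpow_pos_of_pos ht.1 m
      have ht2 : 0 < t ^ 2 := pow_pos ht.1 2
      have hle : t ^ m ≤ d ^ m := Real.rpow_le_rpow ht.1.le ht.2 (by linarith)
      rw [hpow t ht.1, Real.norm_of_nonneg (by positivity), div_div_eq_mul_div,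
        div_le_iff₀ ht2]
      calc h t ^ 2 * t ^ m ≤ (M ^ 2 * t ^ 2) * d ^ m := by
            gcongr
            exact hsq t (Ioc_subset_Icc_self ht)
        _ = _ := by ring
  have int3 : IntervalIntegrable (fun t => h' t ^ 2) volume 0 d :=
    ((hh'.pow 2).mono (by rw [uIcc_of_le hd.le])).intervalIntegrable
  refine ⟨int1, int2, ?_⟩
  set ρ : ℝ → ℝ := fun t => 1 / (2 * t) - t ^ (m - 1) / (2 * d ^ m) with hρ
  have hρeq : ∀ t, 0 < t → ρ t = (1 - t ^ m / d ^ m) / (2 * t) := by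
    intro t ht
    simp only [hρ]
    rw [Real.rpow_sub_one ht.ne']
    field_simp
  have hτ : ∀ t ∈ Ioc 0 d, 0 ≤ t ^ m / d ^ m ∧ t ^ m / d ^ m ≤ 1 := by
    intro t ht
    exact ⟨div_nonneg (Real.rpow_nonneg ht.1.le _) hdm.le,
      (div_le_one hdm).2 (Real.rpow_le_rpow ht.1.le ht.2 (by linarith))⟩
  have hρderiv : ∀ t, 0 < t →
      HasDerivAt ρ (-(1 + (m - 1) * (t ^ m / d ^ m)) / (2 * t ^ 2)) t := by
    intro t ht
    have h1 : HasDerivAt (fun t : ℝ => 1 / (2 * t)) (-(1 / (2 * t ^ 2))) t := by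
      have := ((hasDerivAt_id t).const_mul 2).inv (by simpa using ht.ne')
      simp only [one_div]
      refine this.congr_deriv ?_
      simp only [id]
      field_simp
    have h2 := (Real.hasDerivAt_rpow_const (x := t) (p := m - 1) (Or.inl ht.ne')).div_const
      (2 * d ^ m)
    refine (h1.sub h2).congr_deriv ?_
    rw [Real.rpow_sub_one ht.ne', Real.rpow_sub_one ht.ne']
    field_simp
    ring
  have hbound : ∀ t ∈ Icc 0 d, ‖K * (ρ t * h t ^ 2)‖ ≤ K * (M ^ 2 / 2 * t) := by
    intro t ht
    rcases ht.1.eq_or_lt with rfl | htpos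
    · simp [h0]
    · obtain ⟨hτ0, hτ1⟩ := hτ t ⟨htpos, ht.2⟩
      have hn : 0 ≤ 1 - t ^ m / d ^ m := by linarith
      rw [hρeq t htpos, Real.norm_of_nonneg (by positivity)]
      refine mul_le_mul_of_nonneg_left ?_ hK
      calc (1 - t ^ m / d ^ m) / (2 * t) * h t ^ 2 ≤ 1 / (2 * t) * (M ^ 2 * t ^ 2) := by
            gcongr
            · linarith
            · exact hsq t ht
        _ = M ^ 2 / 2 * t := by field_simp
  have hfcont : ContinuousOn (fun t => K * (ρ t * h t ^ 2)) (Icc 0 d) := by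
    intro t ht
    rcases ht.1.eq_or_lt with rfl | htpos
    · have hlim : Tendsto (fun t : ℝ => K * (M ^ 2 / 2 * t)) (nhdsWithin 0 (Icc 0 d)) (nhds 0) := by
        have : ContinuousWithinAt (fun t : ℝ => K * (M ^ 2 / 2 * t)) (Icc 0 d) 0 := by fun_prop
        simpa [ContinuousWithinAt] using this
      have := squeeze_zero_norm' (eventually_mem_nhdsWithin.mono hbound) hlim
      simpa [ContinuousWithinAt, h0] using this
    · exact (((hρderiv t htpos).mul ((hh t ht).pow 2)).const_mul K).continuousAt.continuousWithinAt
  have hmain := intervalIntegral.sub_le_integral_of_hasDeriv_right_of_le (a := 0) (b := d)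
    (φ := fun t => K * h' t ^ 2 - P * (h t ^ 2 / t ^ 2)
      - R / d ^ m * (h t ^ 2 / t ^ ((2 : ℝ) - m)))
    hd.le hfcont
    (fun t ht => (((hρderiv t ht.1).mul
      ((hh t (Ioo_subset_Icc_self ht)).pow 2)).const_mul K).hasDerivWithinAt)
    ((intervalIntegrable_iff_integrableOn_Icc_of_le hd.le).1
      (((int3.const_mul K).sub (int1.const_mul P)).sub (int2.const_mul (R / d ^ m))))
    (fun t ht => by
      obtain ⟨hτ0, hτ1⟩ := hτ t (Ioo_subset_Ioc_self ht)
      have hq := hardy_quadratic_le (q := h t / t) (p := h' t) hK hP hPR hτ0 hτ1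
      have ht0 : t ≠ 0 := ht.1.ne'
      have htm : t ^ m ≠ 0 := (Real.rpow_pos_of_pos ht.1 m).ne'
      rw [hρeq t ht.1, hpow t ht.1]
      convert hq using 1
      · push_cast
        simp only [pow_one, Pi.pow_apply]
        field_simp
        ring
      · field_simp)
  rw [intervalIntegral.integral_sub ((int3.const_mul K).sub (int1.const_mul P))
      (int2.const_mul (R / d ^ m)),
    intervalIntegral.integral_sub (int3.const_mul K) (int1.const_mul P)] at hmain
  simp only [intervalIntegral.integral_const_mul, h0, hρeq d hd, div_self hdm.ne'] at hmain
  norm_num at hmain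
  linarith

theorem hardy_interval {a b m P R K : ℝ} {g g' : ℝ → ℝ} (hab : a < b) (hm : 1 < m)
    (hK : 0 ≤ K) (hP : P ≤ K / 4) (hPR : P + R ≤ K * m / 2)
    (hg : ∀ x ∈ Icc a b, HasDerivAt g (g' x) x) (hg' : ContinuousOn g' (Icc a b))
    (hga : g a = 0) (hgb : g b = 0) :
    P * (∫ x in Ioo a b, |g x| ^ 2 / (min (b - x) (x - a)) ^ 2)
      + R / ((b - a) / 2) ^ m *
        (∫ x in Ioo a b, |g x| ^ 2 / (min (b - x) (x - a)) ^ ((2 : ℝ) - m))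
      ≤ K * ∫ x in Ioo a b, |g' x| ^ 2 := by
  set d := (b - a) / 2 with hd_def
  have hd : 0 < d := by rw [hd_def]; linarith
  obtain ⟨il1, il2, hl⟩ := hardy_half_interval (h := fun t => g (a + t))
    (h' := fun t => g' (a + t)) hd hm hK hP hPR
    (fun t ht => (hg (a + t) ⟨by linarith [ht.1], by linarith [ht.2]⟩).comp_const_add a t)
    (hg'.comp (by fun_prop) fun t ht => ⟨by linarith [ht.1], by linarith [ht.2]⟩)
    (by simpa using hga)
  obtain ⟨ir1, ir2, hr⟩ := hardy_half_interval (h := fun t => g (b - t))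
    (h' := fun t => -g' (b - t)) hd hm hK hP hPR
    (fun t ht => (hg (b - t) ⟨by linarith [ht.2], by linarith [ht.1]⟩).comp_const_sub b t)
    ((hg'.comp (by fun_prop) fun t ht => ⟨by linarith [ht.2], by linarith [ht.1]⟩).neg)
    (by simpa using hgb)
  -- Folding an integral over `(a, b)` onto the half interval `(0, d)`.
  have fold : ∀ F : ℝ → ℝ → ℝ,
      IntervalIntegrable (fun t => F (a + t) t) volume 0 d →
      IntervalIntegrable (fun t => F (b - t) t) volume 0 d →
      ∫ x in Ioo a b, F x (min (b - x) (x - a))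
        = (∫ t in (0 : ℝ)..d, F (a + t) t) + ∫ t in (0 : ℝ)..d, F (b - t) t := by
    intro F hF1 hF2
    have e1 : ∀ t ∈ uIcc 0 d, F (a + t) (min (b - (a + t)) (a + t - a)) = F (a + t) t := by
      intro t ht
      rw [uIcc_of_le hd.le] at ht
      rw [min_eq_right (by linarith [ht.2]), add_sub_cancel_left]
    have e2 : ∀ t ∈ uIcc 0 d, F (b - t) (min (b - (b - t)) (b - t - a)) = F (b - t) t := by
      intro t ht
      rw [uIcc_of_le hd.le] at ht
      rw [min_eq_left (by linarith [ht.2]), sub_sub_cancel]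
    have hmid : b - d = a + d := by rw [hd_def]; ring
    have i1 : IntervalIntegrable (fun x => F x (min (b - x) (x - a))) volume a (a + d) := by
      have := (hF1.congr fun t ht => (e1 t (uIoc_subset_uIcc ht)).symm).comp_sub_right a
      simpa [add_comm d a] using this
    have i2 : IntervalIntegrable (fun x => F x (min (b - x) (x - a))) volume (a + d) b := by
      have := (hF2.congr fun t ht => (e2 t (uIoc_subset_uIcc ht)).symm).comp_sub_left b
      simpa [hmid] using this.symm
    rw [← integral_Ioc_eq_integral_Ioo, ← intervalIntegral.integral_of_le hab.le,
      ← intervalIntegral.integral_add_adjacent_intervals i1 i2,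
      ← intervalIntegral.integral_congr e1, ← intervalIntegral.integral_congr e2,
      intervalIntegral.integral_comp_add_left (fun x => F x (min (b - x) (x - a))) a,
      intervalIntegral.integral_comp_sub_left (fun x => F x (min (b - x) (x - a))) b,
      hmid, add_zero, sub_zero]
  have il3 : IntervalIntegrable (fun t => |g' (a + t)| ^ 2) volume 0 d := by
    refine ContinuousOn.intervalIntegrable (ContinuousOn.pow (ContinuousOn.abs
      (hg'.comp (by fun_prop) fun t ht => ?_)) 2)
    rw [uIcc_of_le hd.le] at ht
    exact ⟨by linarith [ht.1], by linarith [ht.2]⟩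
  have ir3 : IntervalIntegrable (fun t => |g' (b - t)| ^ 2) volume 0 d := by
    refine ContinuousOn.intervalIntegrable (ContinuousOn.pow (ContinuousOn.abs
      (hg'.comp (by fun_prop) fun t ht => ?_)) 2)
    rw [uIcc_of_le hd.le] at ht
    exact ⟨by linarith [ht.2], by linarith [ht.1]⟩
  simp only [abs_neg] at hr
  rw [fold (fun x y => |g x| ^ 2 / y ^ 2) il1 ir1,
    fold (fun x y => |g x| ^ 2 / y ^ ((2 : ℝ) - m)) il2 ir2,
    fold (fun x _ => |g' x| ^ 2) il3 ir3]
  linarith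

theorem stmt_14 (m ν lam c jν a b : ℝ) (g g' : ℝ → ℝ)
    (hm : 1 < m) (hν : ν ∈ Set.Icc 0 (1 / m))
    (hlam : lam ∈ Set.Ico 0 ((1 + ν * m) / 2))
    (hc : 0 < c)
    (hjν_pos : 0 < jν) (hjν_zero : besselJ ν jν = 0)
    (hjν_first : ∀ t ∈ Set.Ioo 0 jν, 0 < besselJ ν t)
    (hcm : 2 * c / m ∈ Set.Ioo 0 jν)
    (hroot : (1 - 2 * lam) * besselJ ν (2 * c / m)
      + 2 * c * deriv (besselJ ν) (2 * c / m) = 0)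
    (hab : a < b)
    (hg : ∀ x ∈ Set.Icc a b, HasDerivAt g (g' x) x)
    (hg' : ContinuousOn g' (Set.Icc a b))
    (hga : g a = 0) (hgb : g b = 0) :
    (1 - ν ^ 2 * m ^ 2) / 4 * (∫ x in Set.Ioo a b, |g x| ^ 2 / (min (b - x) (x - a)) ^ 2)
      + (c ^ 2 + (m - 1) * (lam - lam ^ 2)) / ((b - a) / 2) ^ m *
        (∫ x in Set.Ioo a b, |g x| ^ 2 / (min (b - x) (x - a)) ^ ((2:ℝ) - m))
    ≤ 4 * ((1 + ν * m) / 2 - lam ^ 2) * (∫ x in Set.Ioo a b, |g' x| ^ 2) := by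
  obtain ⟨hν0, hν1⟩ := hν
  obtain ⟨hl0, hl1⟩ := hlam
  have hνm : ν * m ≤ 1 := (le_div_iff₀ (by linarith)).1 hν1
  have hνm0 : 0 ≤ ν * m := by positivity
  have hcsq := sq_le_of_besselJ_robin (by linarith) hν0 hc hjν_first hcm hroot
  obtain ⟨μ, hμ⟩ : ∃ μ, μ = (1 + ν * m) / 2 := ⟨_, rfl⟩
  have hν' : ν * m = 2 * μ - 1 := by linarith
  have hcsq' : c ^ 2 ≤ (μ - lam) * (m + 2 * μ - 1) := by
    refine hcsq.trans_eq ?_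
    rw [← hμ, mul_add, mul_comm m ν, hν']
    ring
  have hsq : ν ^ 2 * m ^ 2 = (2 * μ - 1) ^ 2 := by rw [← mul_pow, hν']
  rw [← hμ] at hl1 ⊢
  have hμ1 : μ ≤ 1 := by linarith
  have hlμ : lam ^ 2 ≤ μ ^ 2 := pow_le_pow_left₀ hl0 hl1.le 2
  have hμμ : 0 ≤ μ - μ ^ 2 := by nlinarith
  refine hardy_interval hab hm (by nlinarith) ?_ ?_ hg hg' hga hgb
  · rw [hsq]
    nlinarith
  · rw [hsq]
    nlinarith [mul_nonneg (sub_nonneg.2 hm.le) (by linarith : 0 ≤ μ - lam ^ 2),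
      mul_nonneg hl0 (sub_nonneg.2 hl1.le)]
end

section
/- Let Ω be an open convex proper subset of ℝⁿ with finite inner radius δ₀ = sup_{x∈Ω} dist(x, ∂Ω). Let m > 0, ν ∈ (0, 1/m], λ ∈ [0, (1 + νm)/2), and let c > 0 satisfy (1 − 2λ)·J_ν(2c/m) + 2c·J′_ν(2c/m) = 0 with 2c/m ∈ (0, j_ν). Then for every f ∈ C₀¹(Ω) with |∇f|/δ ∈ L¹(Ω): ((1 − ν²m²)/4)·∫_Ω |f(x)|/δ(x)² dx + (c²/δ₀^m)·∫_Ω |f(x)|/δ(x)^{2−m} dx ≤ ((1 + νm)/2 − λ²)·∫_Ω |∇f(x)|/δ(x) dx + ((λ² − λ)/δ₀)·∫_Ω |∇f(x)| dx. -/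
open MeasureTheory Real Set Filter

/-- A power series whose coefficients are `O(1 / k!)` converges absolutely everywhere. -/
theorem summable_mul_pow_of_abs_le_div_factorial {a : ℕ → ℝ} {C : ℝ}
    (ha : ∀ k, |a k| ≤ C / (k.factorial : ℝ)) (y : ℝ) :
    Summable fun k => a k * y ^ k := by
  refine Summable.of_norm_bounded ((Real.summable_pow_div_factorial |y|).mul_left C) fun k => ?_
  rw [norm_mul, norm_pow, Real.norm_eq_abs, Real.norm_eq_abs, mul_div_assoc', mul_div_right_comm]
  exact mul_le_mul_of_nonneg_right (ha k) (by positivity)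

theorem abs_succ_mul_coeff_le {a : ℕ → ℝ} {C : ℝ}
    (ha : ∀ k, |a k| ≤ C / (k.factorial : ℝ)) (k : ℕ) :
    |((k : ℝ) + 1) * a (k + 1)| ≤ C / (k.factorial : ℝ) := by
  have h := ha (k + 1)
  rw [Nat.factorial_succ, Nat.cast_mul, Nat.cast_succ] at h
  rw [abs_mul, abs_of_pos (by positivity : (0 : ℝ) < k + 1)]
  calc ((k : ℝ) + 1) * |a (k + 1)| ≤ (k + 1) * (C / ((k + 1) * k.factorial)) := by gcongr
    _ = C / k.factorial := by field_simp

/-- Termwise differentiation of a power series with coefficients `O(1 / k!)`. -/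
theorem hasDerivAt_tsum_mul_pow {a : ℕ → ℝ} {C : ℝ}
    (ha : ∀ k, |a k| ≤ C / (k.factorial : ℝ)) (y : ℝ) :
    HasDerivAt (fun y : ℝ => ∑' k, a k * y ^ k)
      (∑' k : ℕ, (((k : ℝ) + 1) * a (k + 1)) * y ^ k) y := by
  have hb := abs_succ_mul_coeff_le ha
  set r := |y| + 1
  have hr : 0 ≤ r := by positivity
  have hbound : Summable fun k : ℕ => |a k| * (k * r ^ (k - 1)) := by
    rw [← summable_nat_add_iff 1]
    refine (summable_mul_pow_of_abs_le_div_factorial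
      (a := fun k => |((k : ℝ) + 1) * a (k + 1)|) (C := C) (by simpa using hb) r).congr
      fun k => ?_
    rw [abs_mul, abs_of_pos (by positivity : (0 : ℝ) < k + 1)]
    push_cast
    ring_nf
  have h := hasDerivAt_tsum_of_isPreconnected (𝕜 := ℝ) (F := ℝ) (t := Metric.ball 0 r)
    (g := fun k y => a k * y ^ k) (g' := fun k y => a k * (k * y ^ (k - 1))) hbound
    Metric.isOpen_ball (convex_ball _ _).isPreconnected
    (fun k z _ => (hasDerivAt_pow k z).const_mul (a k))
    (fun k z hz => by
      rw [norm_mul, norm_mul, norm_pow, RCLike.norm_natCast, Real.norm_eq_abs]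
      have : ‖z‖ ≤ r := by simpa using (Metric.mem_ball.1 hz).le
      gcongr)
    (y₀ := 0) (by simp; positivity) (summable_mul_pow_of_abs_le_div_factorial ha 0)
    (y := y) (by simp [r])
  refine h.congr_deriv ?_
  have hs : Summable fun k : ℕ => a k * (k * y ^ (k - 1)) := by
    rw [← summable_nat_add_iff 1]
    refine (summable_mul_pow_of_abs_le_div_factorial hb y).congr fun k => ?_
    push_cast
    ring_nf
  rw [hs.tsum_eq_zero_add]
  simp only [Nat.cast_zero, zero_mul, mul_zero, zero_add]
  refine tsum_congr fun k => ?_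
  push_cast
  ring_nf

/-- `besselJ ν x = (x / 2) ^ ν * P (x ^ 2)` for an entire `P` solving the reduced Bessel equation. -/
theorem exists_besselJ_eq_rpow_mul {ν : ℝ} (hν : 0 < ν) :
    ∃ P P₁ P₂ : ℝ → ℝ, (∀ y, HasDerivAt P (P₁ y) y) ∧ (∀ y, HasDerivAt P₁ (P₂ y) y) ∧
      (∀ y, 4 * y * P₂ y + 4 * (ν + 1) * P₁ y + P y = 0) ∧ 0 < P 0 ∧
      ∀ x, 0 < x → besselJ ν x = (x / 2) ^ ν * P (x ^ 2) := by
  set a : ℕ → ℝ := fun k => (-1) ^ k / (4 ^ k * (k.factorial : ℝ) * Gamma (k + 1 + ν)) with ha_def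
  have hG : ∀ k : ℕ, 0 < Gamma (k + 1 + ν) := fun k => Gamma_pos_of_pos (by positivity)
  have hrec : ∀ k : ℕ, 4 * ((k : ℝ) + 1) * (k + 1 + ν) * a (k + 1) = -a k := by
    intro k
    have h : Gamma ((k : ℝ) + 1 + 1 + ν) = (k + 1 + ν) * Gamma (k + 1 + ν) := by
      rw [← Gamma_add_one (by positivity)]; congr 1; ring
    have := hG k
    have h2 : (k : ℝ) + 1 + ν ≠ 0 := by positivity
    simp only [ha_def, Nat.factorial_succ, Nat.cast_mul, Nat.cast_succ, pow_succ, h]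
    field_simp
  have ha : ∀ k, |a k| ≤ |a 0| / (k.factorial : ℝ) := by
    intro k
    induction k with
    | zero => simp
    | succ k ih =>
      have h := congrArg abs (hrec k)
      rw [abs_neg, abs_mul, abs_of_pos (by positivity)] at h
      rw [Nat.factorial_succ, Nat.cast_mul, Nat.cast_succ, le_div_iff₀ (by positivity)]
      rw [le_div_iff₀ (by positivity), ← h] at ih
      have h1 : (1 : ℝ) ≤ 4 * (k + 1 + ν) := by
        have : (0 : ℝ) ≤ k := by positivity
        linarith
      have h2 : 0 ≤ |a (k + 1)| * ((k + 1) * (k.factorial : ℝ)) := by positivity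
      nlinarith
  have hb := abs_succ_mul_coeff_le ha
  have hc := abs_succ_mul_coeff_le hb
  refine ⟨_, _, _, hasDerivAt_tsum_mul_pow ha, hasDerivAt_tsum_mul_pow hb, fun y => ?_, ?_,
    fun x hx => ?_⟩
  · have hsa := summable_mul_pow_of_abs_le_div_factorial ha y
    have hsb := summable_mul_pow_of_abs_le_div_factorial hb y
    have hsc := summable_mul_pow_of_abs_le_div_factorial hc y
    have hsd : Summable fun k : ℕ => k * ((k + 1) * a (k + 1)) * y ^ k := by
      rw [← summable_nat_add_iff 1]
      refine (hsc.mul_left y).congr fun k => ?_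
      push_cast
      ring
    have hd : y * ∑' k : ℕ, ((k : ℝ) + 1) * (((k + 1 : ℕ) + 1) * a (k + 1 + 1)) * y ^ k
        = ∑' k : ℕ, k * ((k + 1) * a (k + 1)) * y ^ k := by
      rw [hsd.tsum_eq_zero_add, ← tsum_mul_left]
      simp only [Nat.cast_zero, zero_mul, zero_add]
      refine tsum_congr fun k => ?_
      push_cast
      ring
    rw [mul_assoc, hd, ← tsum_mul_left, ← tsum_mul_left, ← (hsd.mul_left 4).tsum_add (hsb.mul_left _),
      ← ((hsd.mul_left 4).add (hsb.mul_left _)).tsum_add hsa]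
    rw [← tsum_zero (α := ℝ) (β := ℕ)]
    refine tsum_congr fun k => ?_
    linear_combination y ^ k * hrec k
  · have : ∑' k, a k * (0 : ℝ) ^ k = a 0 := by
      rw [tsum_eq_single 0 (fun k hk => by simp [hk])]; simp
    rw [this]
    have := hG 0
    simp only [ha_def, pow_zero, Nat.factorial_zero, Nat.cast_one, mul_one, one_mul]
    positivity
  · rw [besselJ, ← tsum_mul_left]
    refine tsum_congr fun k => ?_
    rw [rpow_add hx, rpow_add two_pos, div_rpow hx.le two_pos.le]
    have e : ∀ z : ℝ, 0 < z → z ^ (2 * (k : ℝ)) = (z ^ 2) ^ k := fun z hz => by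
      rw [← pow_mul, ← rpow_natCast]; push_cast; rfl
    rw [e x hx, e 2 two_pos, show (2 : ℝ) ^ 2 = 4 by norm_num]
    have := hG k
    have : (0 : ℝ) < 2 ^ ν := by positivity
    simp only [ha_def]
    field_simp

/-- The logarithmic derivative (multiplied by `x`) of a Bessel function, up to a point `S`
before its first zero: it solves a Riccati equation, is at most `ν` and is minimal at `S`. -/
theorem exists_besselJ_logDeriv {ν S : ℝ} (hν : 0 < ν) (hS : 0 < S)
    (hpos : ∀ x ∈ Ioc 0 S, 0 < besselJ ν x) :
    ∃ u : ℝ → ℝ, u S * besselJ ν S = S * deriv (besselJ ν) S ∧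
      ∀ x ∈ Ioc 0 S, HasDerivAt u ((ν ^ 2 - x ^ 2 - u x ^ 2) / x) x ∧ u x ≤ ν ∧ u S ≤ u x := by
  obtain ⟨P, P₁, P₂, hP, hP₁, hode, hP0, hJ⟩ := exists_besselJ_eq_rpow_mul hν
  have hPpos : ∀ x ∈ Icc 0 S, 0 < P (x ^ 2) := by
    intro x hx
    rcases hx.1.eq_or_lt with rfl | h
    · simpa using hP0
    · have := hpos x ⟨h, hx.2⟩
      rw [hJ x h] at this
      exact pos_of_mul_pos_right this (by positivity)
  have hsq : ∀ x : ℝ, HasDerivAt (fun x : ℝ => x ^ 2) (2 * x) x := fun x => by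
    simpa using hasDerivAt_pow 2 x
  have hPx : ∀ x, HasDerivAt (fun x => P (x ^ 2)) (P₁ (x ^ 2) * (2 * x)) x := fun x =>
    (hP (x ^ 2)).comp x (hsq x)
  have hP₁x : ∀ x, HasDerivAt (fun x => P₁ (x ^ 2)) (P₂ (x ^ 2) * (2 * x)) x := fun x =>
    (hP₁ (x ^ 2)).comp x (hsq x)
  set u : ℝ → ℝ := fun x => ν + 2 * x ^ 2 * P₁ (x ^ 2) / P (x ^ 2) with hu
  have hu_deriv : ∀ x ∈ Ioc 0 S, HasDerivAt u ((ν ^ 2 - x ^ 2 - u x ^ 2) / x) x := by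
    intro x hx
    have hp := hPpos x ⟨hx.1.le, hx.2⟩
    have hx0 : x ≠ 0 := hx.1.ne'
    have h := (((((hsq x).const_mul 2).mul (hP₁x x)).div (hPx x) hp.ne').const_add ν)
    refine h.congr_deriv ?_
    simp only [hu, Pi.mul_apply]
    field_simp
    linear_combination (x ^ 2 * P (x ^ 2)) * hode (x ^ 2)
  have hu_cont : ContinuousOn u (Icc 0 S) := by
    intro x hx
    have hp := hPpos x hx
    exact (((((hsq x).const_mul 2).mul (hP₁x x)).div (hPx x) hp.ne').const_add
      ν).continuousAt.continuousWithinAt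
  -- the energy of the Bessel equation
  set G : ℝ → ℝ := fun x => x ^ (2 * ν) *
    ((ν * P (x ^ 2) + 2 * x ^ 2 * P₁ (x ^ 2)) ^ 2 + (x ^ 2 - ν ^ 2) * P (x ^ 2) ^ 2) with hG
  have hG_deriv : ∀ x, 0 < x → HasDerivAt G (2 * x * x ^ (2 * ν) * P (x ^ 2) ^ 2) x := by
    intro x hx
    have h1 := Real.hasDerivAt_rpow_const (x := x) (p := 2 * ν) (Or.inl hx.ne')
    have h2 := ((((hPx x).const_mul ν).add (((hsq x).const_mul 2).mul (hP₁x x))).pow 2).add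
      (((hsq x).sub_const (ν ^ 2)).mul ((hPx x).pow 2))
    refine (h1.mul h2).congr_deriv ?_
    rw [rpow_sub_one hx.ne']
    have hx0 : x ≠ 0 := hx.ne'
    simp only [Pi.add_apply, Pi.mul_apply, Pi.pow_apply]
    field_simp
    push_cast
    linear_combination (x ^ 2 * (ν * P (x ^ 2) + 2 * x ^ 2 * P₁ (x ^ 2))) * hode (x ^ 2)
  have hG_cont : ContinuousOn G (Icc 0 S) := by
    have c1 : Continuous fun x => P (x ^ 2) :=
      continuous_iff_continuousAt.2 fun x => (hPx x).continuousAt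
    have c2 : Continuous fun x => P₁ (x ^ 2) :=
      continuous_iff_continuousAt.2 fun x => (hP₁x x).continuousAt
    have c3 : Continuous fun x : ℝ => x ^ (2 * ν) :=
      continuous_id.rpow_const fun x => Or.inr (by positivity)
    exact (c3.mul ((((continuous_const.mul c1).add ((by fun_prop : Continuous fun x : ℝ =>
      2 * x ^ 2).mul c2)).pow 2).add ((by fun_prop : Continuous fun x : ℝ =>
      x ^ 2 - ν ^ 2).mul (c1.pow 2)))).continuousOn
  have hG_mono : MonotoneOn G (Icc 0 S) := by
    refine monotoneOn_of_deriv_nonneg (convex_Icc 0 S) hG_cont ?_ ?_ <;>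
      rw [interior_Icc]
    · exact fun x hx => (hG_deriv x hx.1).differentiableAt.differentiableWithinAt
    · intro x hx
      have := hx.1
      rw [(hG_deriv x hx.1).deriv]
      positivity
  have hG0 : G 0 = 0 := by simp [hG, zero_rpow (by positivity : 2 * ν ≠ 0)]
  have henergy : ∀ x ∈ Ioc 0 S, ν ^ 2 - x ^ 2 - u x ^ 2 ≤ 0 := by
    intro x hx
    have hp := hPpos x ⟨hx.1.le, hx.2⟩
    have h := hG_mono ⟨le_rfl, hS.le⟩ ⟨hx.1.le, hx.2⟩ hx.1.le
    rw [hG0] at h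
    have hr : 0 < x ^ (2 * ν) := rpow_pos_of_pos hx.1 _
    have h' := nonneg_of_mul_nonneg_right h hr
    have e : (ν * P (x ^ 2) + 2 * x ^ 2 * P₁ (x ^ 2)) = u x * P (x ^ 2) := by
      simp only [hu]; field_simp
    rw [e] at h'
    have : 0 ≤ (u x ^ 2 + x ^ 2 - ν ^ 2) * P (x ^ 2) ^ 2 := by linarith
    have := nonneg_of_mul_nonneg_left this (by positivity)
    linarith
  have hu_anti : AntitoneOn u (Icc 0 S) := by
    refine antitoneOn_of_deriv_nonpos (convex_Icc 0 S) hu_cont ?_ ?_ <;>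
      rw [interior_Icc]
    · exact fun x hx =>
        (hu_deriv x ⟨hx.1, hx.2.le⟩).differentiableAt.differentiableWithinAt
    · intro x hx
      rw [(hu_deriv x ⟨hx.1, hx.2.le⟩).deriv]
      exact div_nonpos_of_nonpos_of_nonneg (henergy x ⟨hx.1, hx.2.le⟩) hx.1.le
  refine ⟨u, ?_, fun x hx => ⟨hu_deriv x hx, ?_, ?_⟩⟩
  · have hp := hPpos S ⟨hS.le, le_rfl⟩
    have h1 : HasDerivAt (fun x : ℝ => (x / 2) ^ ν) (1 / 2 * ν * (S / 2) ^ (ν - 1)) S :=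
      ((hasDerivAt_id S).div_const 2).rpow_const (Or.inl (by simp; positivity))
    have h2 := (h1.mul (hPx S)).congr_of_eventuallyEq
      ((eventually_gt_nhds hS).mono fun x hx => hJ x hx)
    rw [h2.deriv, hJ S hS, rpow_sub_one (by positivity)]
    simp only [hu]
    field_simp
  · have := hu_anti ⟨le_rfl, hS.le⟩ ⟨hx.1.le, hx.2⟩ hx.1.le
    simpa [hu] using this
  · exact hu_anti ⟨hx.1.le, hx.2⟩ ⟨hS.le, le_rfl⟩ hx.2

/-- The potential on the left-hand side of the Hardy inequality, as a function of the distance. -/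
noncomputable def hardyPotential (m ν c a t : ℝ) : ℝ :=
  (1 - ν ^ 2 * m ^ 2) / 4 / t ^ 2 + c ^ 2 / a ^ m / t ^ (2 - m)

theorem continuousOn_hardyPotential (m ν c a : ℝ) :
    ContinuousOn (hardyPotential m ν c a) (Ioi 0) := by
  unfold hardyPotential
  refine (continuousOn_const.div (continuousOn_pow 2) fun t (ht : 0 < t) => by positivity).add
    (continuousOn_const.div (continuousOn_id.rpow_const fun t (ht : 0 < t) => Or.inl ht.ne')
      fun t (ht : 0 < t) => (rpow_pos_of_pos ht _).ne')

theorem hardyPotential_nonneg {m ν c a t : ℝ} (hm : 0 < m) (hν : ν ∈ Ioc 0 (1 / m))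
    (ha : 0 < a) (ht : 0 < t) : 0 ≤ hardyPotential m ν c a t := by
  have h1 : ν * m ≤ 1 := (le_div_iff₀ hm).1 hν.2
  have h0 : 0 < ν * m := mul_pos hν.1 hm
  have : 0 ≤ 1 - ν ^ 2 * m ^ 2 := by nlinarith
  unfold hardyPotential
  positivity

/-- The antiderivative of the Hardy potential vanishing at `a` is dominated by the weight on the
right-hand side of the Hardy inequality. -/
theorem exists_antideriv_hardyPotential_le {m ν lam c a : ℝ} (hm : 0 < m)
    (hν : ν ∈ Ioc 0 (1 / m)) (hlam : 0 ≤ lam) (hc : 0 < c) (ha : 0 < a)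
    (hpos : ∀ x ∈ Ioc 0 (2 * c / m), 0 < besselJ ν x)
    (hroot : (1 - 2 * lam) * besselJ ν (2 * c / m)
      + 2 * c * deriv (besselJ ν) (2 * c / m) = 0) :
    ∃ Q : ℝ → ℝ, (∀ t, 0 < t → HasDerivAt Q (-hardyPotential m ν c a t) t) ∧
      ∀ t ∈ Ioc 0 a, 0 ≤ Q t ∧
        Q t ≤ ((1 + ν * m) / 2 - lam ^ 2) / t + (lam ^ 2 - lam) / a := by
  set q := hardyPotential m ν c a with hq_def
  have hqc : ContinuousOn q (Ioi 0) := continuousOn_hardyPotential m ν c a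
  have hQ : ∀ t, 0 < t → HasDerivAt (fun t => ∫ s in t..a, q s) (-q t) t := by
    intro t ht
    refine intervalIntegral.integral_hasDerivAt_left ?_
      (hqc.stronglyMeasurableAtFilter isOpen_Ioi t ht) (hqc.continuousAt (Ioi_mem_nhds ht))
    exact (hqc.mono fun s hs => (lt_min ht ha).trans_le hs.1).intervalIntegrable
  refine ⟨_, hQ, fun t ht => ⟨intervalIntegral.integral_nonneg ht.2 fun s hs =>
    hardyPotential_nonneg hm hν ha (ht.1.trans_le hs.1), ?_⟩⟩
  set S := 2 * c / m with hS_def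
  have hS : 0 < S := by positivity
  obtain ⟨u, huS, hu⟩ := exists_besselJ_logDeriv hν.1 hS hpos
  set s : ℝ → ℝ := fun t => S * (t / a) ^ (m / 2) with hs_def
  have hs_mem : ∀ t ∈ Ioc 0 a, s t ∈ Ioc 0 S := by
    intro t ht
    have h0 : 0 < t / a := div_pos ht.1 ha
    refine ⟨by positivity, mul_le_of_le_one_right hS.le ?_⟩
    exact rpow_le_one h0.le ((div_le_one ha).2 ht.2) (by positivity)
  have hs_deriv : ∀ t, 0 < t → HasDerivAt s (m / 2 * s t / t) t := by
    intro t ht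
    have h0 : 0 < t / a := div_pos ht ha
    have h := (((hasDerivAt_id t).div_const a).rpow_const (p := m / 2)
      (Or.inl h0.ne')).const_mul S
    refine h.congr_deriv ?_
    simp only [id, hs_def]
    rw [rpow_sub_one h0.ne']
    field_simp
  have hs_sq : ∀ t, 0 < t → c ^ 2 / a ^ m / t ^ (2 - m) = m ^ 2 * s t ^ 2 / 4 / t ^ 2 := by
    intro t ht
    have h0 : 0 < t / a := div_pos ht ha
    have e : ((t / a) ^ (m / 2)) ^ 2 = t ^ m / a ^ m := by
      rw [← rpow_natCast, ← rpow_mul h0.le, ← div_rpow ht.le ha.le]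
      congr 1
      push_cast
      ring
    have h1 : 0 < a ^ m := by positivity
    have h2 : 0 < t ^ m := by positivity
    simp only [hs_def, mul_pow, e, hS_def, rpow_sub ht, rpow_two]
    field_simp
    ring
  set z : ℝ → ℝ := fun t => 1 / 2 + m / 2 * u (s t) with hz_def
  have hsa : s a = S := by simp [hs_def, ha.ne']
  have hza : z a = lam := by
    have hJ := hpos S ⟨hS, le_rfl⟩
    simp only [hz_def, hsa]
    have hmS : m * S = 2 * c := by simp only [hS_def]; field_simp
    have : (1 / 2 + m / 2 * u S) * besselJ ν S = lam * besselJ ν S := by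
      linear_combination m / 2 * huS + deriv (besselJ ν) S / 2 * hmS + hroot / 2
    exact mul_right_cancel₀ hJ.ne' this
  have hz_le : ∀ t ∈ Ioc 0 a, z t ≤ (1 + ν * m) / 2 := by
    intro t ht
    have := (hu (s t) (hs_mem t ht)).2.1
    simp only [hz_def]
    nlinarith
  have hz_ge : ∀ t ∈ Ioc 0 a, lam ≤ z t := by
    intro t ht
    have := (hu (s t) (hs_mem t ht)).2.2
    rw [← hza]
    simp only [hz_def, hsa]
    nlinarith
  set K : ℝ → ℝ := fun t => z t / t - (∫ s in t..a, q s) - lam ^ 2 / t with hK_def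
  have hK_deriv : ∀ t ∈ Ioc 0 a, HasDerivAt K ((lam ^ 2 - z t ^ 2) / t ^ 2) t := by
    intro t ht
    have ht0 : t ≠ 0 := ht.1.ne'
    have hst : s t ≠ 0 := (hs_mem t ht).1.ne'
    have hz : HasDerivAt z (m / 2 * ((ν ^ 2 - s t ^ 2 - u (s t) ^ 2) / s t * (m / 2 * s t / t)))
        t := (((hu (s t) (hs_mem t ht)).1.comp t (hs_deriv t ht.1)).const_mul (m / 2)).const_add
          (1 / 2)
    have h := ((hz.div (hasDerivAt_id t) ht0).sub (hQ t ht.1)).sub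
      ((hasDerivAt_const t (lam ^ 2)).div (hasDerivAt_id t) ht0)
    refine h.congr_deriv ?_
    simp only [hq_def, hardyPotential]
    rw [hs_sq t ht.1]
    simp only [hz_def, id]
    field_simp
    ring
  have hK_anti : AntitoneOn K (Ioc 0 a) := by
    refine antitoneOn_of_deriv_nonpos (convex_Ioc 0 a)
      (fun t ht => (hK_deriv t ht).continuousAt.continuousWithinAt) ?_ ?_ <;> rw [interior_Ioc]
    · exact fun t ht =>
        (hK_deriv t ⟨ht.1, ht.2.le⟩).differentiableAt.differentiableWithinAt
    · intro t ht
      rw [(hK_deriv t ⟨ht.1, ht.2.le⟩).deriv]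
      have := hz_ge t ⟨ht.1, ht.2.le⟩
      exact div_nonpos_of_nonpos_of_nonneg (by nlinarith) (by positivity)
  have h1 := hK_anti ht ⟨ha, le_rfl⟩ ht.2
  simp only [hK_def, hza, intervalIntegral.integral_same] at h1
  have h2 := div_le_div_of_nonneg_right (hz_le t ht) ht.1.le
  rw [sub_div, sub_div]
  linarith

section WeakConcavity

variable {E : Type*} [NormedAddCommGroup E] [NormedSpace ℝ E]

theorem lineDeriv_eq_zero_of_notMem_tsupport {φ : E → ℝ} {x : E} (hx : x ∉ tsupport φ) (v : E) :
    lineDeriv ℝ φ x v = 0 := by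
  have h : φ =ᶠ[nhds x] fun _ => (0 : ℝ) := notMem_tsupport_iff_eventuallyEq.1 hx
  rw [h.lineDeriv_eq]
  simp [lineDeriv]

/-- Increments of a concave function along a line are antitone. -/
theorem ConcaveOn.increment_antitone {Ω : Set E} {g : E → ℝ} (hg : ConcaveOn ℝ Ω g) {x v : E}
    {r₁ r₂ t : ℝ} (hr : r₁ ≤ r₂) (ht : 0 < t) (h₁ : x + r₁ • v ∈ Ω)
    (h₂ : x + (r₂ + t) • v ∈ Ω) :
    g (x + (r₂ + t) • v) - g (x + r₂ • v) ≤ g (x + (r₁ + t) • v) - g (x + r₁ • v) := by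
  have hL : 0 < r₂ + t - r₁ := by linarith
  set α := t / (r₂ + t - r₁) with hα
  have hα0 : 0 ≤ α := by positivity
  have hα1 : α ≤ 1 := (div_le_one hL).2 (by linarith)
  have hαL : α * (r₂ + t - r₁) = t := div_mul_cancel₀ _ hL.ne'
  have e₁ : (1 - α) • (x + r₁ • v) + α • (x + (r₂ + t) • v) = x + (r₁ + t) • v := by
    have : r₁ + t = (1 - α) * r₁ + α * (r₂ + t) := by linear_combination -hαL
    rw [this]
    module
  have e₂ : α • (x + r₁ • v) + (1 - α) • (x + (r₂ + t) • v) = x + r₂ • v := by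
    have : r₂ = α * r₁ + (1 - α) * (r₂ + t) := by linear_combination hαL
    nth_rewrite 2 [this]
    module
  have k₁ := hg.2 h₁ h₂ (sub_nonneg.2 hα1) hα0 (by ring)
  have k₂ := hg.2 h₁ h₂ hα0 (sub_nonneg.2 hα1) (by ring)
  rw [e₁] at k₁
  rw [e₂] at k₂
  simp only [smul_eq_mul] at k₁ k₂
  linarith

variable [FiniteDimensional ℝ E] [MeasurableSpace E] [BorelSpace E] {μ : Measure E}
  [μ.IsAddHaarMeasure]

theorem LipschitzWith.integrable_lineDeriv {D : NNReal} {φ : E → ℝ} (hφ : LipschitzWith D φ)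
    (hsupp : HasCompactSupport φ) (v : E) : Integrable (fun x => lineDeriv ℝ φ x v) μ :=
  ((hφ.locallyIntegrable_lineDeriv v).integrableOn_isCompact
    hsupp).integrable_of_forall_notMem_eq_zero
      fun _ hx => lineDeriv_eq_zero_of_notMem_tsupport hx v

theorem LipschitzWith.integrable_lineDeriv_mul_lineDeriv {C D : NNReal} {g φ : E → ℝ}
    (hg : LipschitzWith C g) (hφ : LipschitzWith D φ) (hsupp : HasCompactSupport φ) (v : E) :
    Integrable (fun x => lineDeriv ℝ g x v * lineDeriv ℝ φ x v) μ :=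
  (hφ.integrable_lineDeriv hsupp v).bdd_mul (hg.memLp_lineDeriv v).aestronglyMeasurable
    (c := C * ‖v‖) (.of_forall fun _ => norm_lineDeriv_le_of_lipschitz ℝ hg)

/-- A concave Lipschitz function has nonpositive second derivatives in the weak sense. -/
theorem ConcaveOn.integral_lineDeriv_mul_lineDeriv_nonneg {Ω : Set E} (hΩ : IsOpen Ω)
    {C D : NNReal} {g φ : E → ℝ} (hconc : ConcaveOn ℝ Ω g) (hg : LipschitzWith C g)
    (hφ : LipschitzWith D φ) (hsupp : HasCompactSupport φ) (hsuppΩ : tsupport φ ⊆ Ω)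
    (hφ0 : ∀ x, 0 ≤ φ x) (v : E) :
    0 ≤ ∫ x, lineDeriv ℝ g x v * lineDeriv ℝ φ x v ∂μ := by
  obtain ⟨η, hη, hηΩ⟩ := hsupp.isCompact.exists_thickening_subset_open hΩ hsuppΩ
  set ε := η / (2 * (‖v‖ + 1)) with hε_def
  have hε : 0 < ε := by positivity
  have hmem : ∀ x ∈ tsupport φ, ∀ r : ℝ, |r| < 2 * ε → x + r • v ∈ Ω := by
    intro x hx r hr
    refine hηΩ (Metric.mem_thickening_iff.2 ⟨x, hx, ?_⟩)
    rw [dist_self_add_left, norm_smul, Real.norm_eq_abs]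
    calc |r| * ‖v‖ ≤ |r| * (‖v‖ + 1) := by gcongr; linarith
      _ < 2 * ε * (‖v‖ + 1) := by gcongr
      _ = η := by simp only [hε_def]; field_simp
  refine ge_of_tendsto (hg.integral_inv_smul_sub_mul_tendsto_integral_lineDeriv_mul
    (hφ.integrable_lineDeriv hsupp v) v) ?_
  filter_upwards [Ioo_mem_nhdsGT hε] with t ht
  have hgt : LipschitzWith (‖t⁻¹‖₊ * (C + C)) fun x => t⁻¹ • (g (x + t • v) - g x) := by
    refine (lipschitzWith_smul t⁻¹).comp (LipschitzWith.sub ?_ hg)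
    simpa [Function.comp_def] using hg.comp (LipschitzWith.id.add (LipschitzWith.const (t • v)))
  have h := hgt.integral_lineDeriv_mul_eq (μ := μ) hφ hsupp (-v)
  rw [neg_neg] at h
  simp only [mul_comm (t⁻¹ • _) _]
  rw [← h]
  refine integral_nonneg fun x => ?_
  by_cases hx : x ∈ tsupport φ
  · refine mul_nonneg ?_ (hφ0 x)
    have hmono : MonotoneOn (fun s : ℝ => t⁻¹ • (g (x + s • (-v) + t • v) - g (x + s • (-v))))
        (Ioo (-ε) ε) := by
      intro s₁ hs₁ s₂ hs₂ hs
      have := hconc.increment_antitone (x := x) (v := v) (neg_le_neg hs) ht.1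
        (hmem x hx _ (by rw [abs_neg, abs_lt]; constructor <;> linarith [hs₂.1, hs₂.2]))
        (hmem x hx _ (by
          rw [abs_lt]; constructor <;> linarith [hs₁.1, hs₁.2, ht.1, ht.2]))
      have e : ∀ s : ℝ, x + (-s) • v + t • v = x + (-s + t) • v := fun s => by module
      have e' : ∀ s : ℝ, x + s • (-v) = x + (-s) • v := fun s => by module
      simp only [e', e, smul_eq_mul]
      exact mul_le_mul_of_nonneg_left this (inv_nonneg.2 ht.1.le)
    have := hmono.derivWithin_nonneg (x := 0)
    rwa [derivWithin_of_mem_nhds (Ioo_mem_nhds (neg_lt_zero.2 hε) hε)] at this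
  · simp [image_eq_zero_of_notMem_tsupport hx]

end WeakConcavity

section DistanceToBoundary

open Metric

variable {E : Type*} [NormedAddCommGroup E] [NormedSpace ℝ E] [FiniteDimensional ℝ E]

theorem infDist_frontier_eq_infDist_compl {Ω : Set E} (hΩ : IsOpen Ω) (hΩu : Ω ≠ univ) {x : E}
    (hx : x ∈ Ω) : infDist x (frontier Ω) = infDist x Ωᶜ := by
  obtain ⟨y, hy, hxy⟩ := exists_mem_frontier_infDist_compl_eq_dist hx hΩu
  refine le_antisymm (hxy ▸ infDist_le_dist_of_mem hy) ?_
  refine infDist_le_infDist_of_subset ?_ ⟨y, hy⟩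
  rw [hΩ.frontier_eq]
  exact fun z hz => hz.2

theorem infDist_frontier_pos {Ω : Set E} (hΩ : IsOpen Ω) (hΩu : Ω ≠ univ) {x : E}
    (hx : x ∈ Ω) : 0 < infDist x (frontier Ω) := by
  rw [infDist_frontier_eq_infDist_compl hΩ hΩu hx]
  exact (hΩ.isClosed_compl.notMem_iff_infDist_pos (nonempty_compl.2 hΩu)).1 (by simpa using hx)

/-- The distance to the boundary of a convex open set is concave. -/
theorem Convex.concaveOn_infDist_frontier {Ω : Set E} (hconv : Convex ℝ Ω) (hΩ : IsOpen Ω)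
    (hΩu : Ω ≠ univ) : ConcaveOn ℝ Ω fun x => infDist x (frontier Ω) := by
  refine ⟨hconv, fun x hx y hy a b ha hb hab => ?_⟩
  have hz := hconv hx hy ha hb hab
  have hxpos := infDist_frontier_pos hΩ hΩu hx
  have hypos := infDist_frontier_pos hΩ hΩu hy
  have hball : ∀ x ∈ Ω, ball x (infDist x (frontier Ω)) ⊆ Ω := fun x hx => by
    rw [infDist_frontier_eq_infDist_compl hΩ hΩu hx]
    exact ball_infDist_compl_subset
  simp only [smul_eq_mul]
  set rx := infDist x (frontier Ω)
  set ry := infDist y (frontier Ω)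
  rw [infDist_frontier_eq_infDist_compl hΩ hΩu hz]
  refine (le_infDist (nonempty_compl.2 hΩu)).2 fun w hw => ?_
  by_contra! hlt
  refine hw ?_
  set r := a * rx + b * ry with hr_def
  have hr : 0 < r := dist_nonneg.trans_lt hlt
  set d := w - (a • x + b • y) with hd
  have hd_norm : ‖d‖ < r := by rwa [hd, ← dist_eq_norm, dist_comm]
  have key : ∀ (p : E) (s : ℝ), 0 < s → p + (s / r) • d ∈ ball p s := by
    intro p s hs
    rw [mem_ball, dist_self_add_left, norm_smul, Real.norm_eq_abs, abs_of_pos (by positivity),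
      div_mul_eq_mul_div, div_lt_iff₀ hr]
    gcongr
  have e : w = a • (x + (rx / r) • d) + b • (y + (ry / r) • d) := by
    have h1 : a * (rx / r) + b * (ry / r) = 1 := by
      rw [mul_div_assoc', mul_div_assoc', ← add_div, ← hr_def, div_self hr.ne']
    have : a • (x + (rx / r) • d) + b • (y + (ry / r) • d)
        = a • x + b • y + (a * (rx / r) + b * (ry / r)) • d := by module
    rw [this, h1, one_smul, hd]
    abel
  rw [e]
  exact hconv (hball x hx (key x rx hxpos)) (hball y hy (key y ry hypos)) ha hb hab

/-- Where it is differentiable, the distance to the boundary satisfies the eikonal equation. -/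
theorem norm_fderiv_infDist_frontier {Ω : Set E} (hΩ : IsOpen Ω) (hΩu : Ω ≠ univ) {x : E}
    (hx : x ∈ Ω) (hd : DifferentiableAt ℝ (fun x => infDist x (frontier Ω)) x) :
    ‖fderiv ℝ (fun x => infDist x (frontier Ω)) x‖ = 1 := by
  set δ : E → ℝ := fun x => infDist x (frontier Ω) with hδ
  refine le_antisymm ?_ ?_
  · simpa using norm_fderiv_le_of_lipschitz ℝ (lipschitz_infDist_pt (frontier Ω)) (x₀ := x)
  obtain ⟨y, hy, hxy⟩ := exists_mem_frontier_infDist_compl_eq_dist hx hΩu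
  rw [← infDist_frontier_eq_infDist_compl hΩ hΩu hx] at hxy
  have hpos := infDist_frontier_pos hΩ hΩu hx
  have hline : HasDerivAt (fun s : ℝ => x + s • (y - x)) (y - x) 0 := by
    simpa using ((hasDerivAt_id (0 : ℝ)).smul_const (y - x)).const_add x
  have hψ : HasDerivAt (fun s : ℝ => δ (x + s • (y - x))) (fderiv ℝ δ x (y - x)) 0 := by
    have h := hd.hasFDerivAt
    rw [show x = x + (0 : ℝ) • (y - x) by simp] at h
    simpa [Function.comp_def] using h.comp_hasDerivAt (0 : ℝ) hline
  have hψ' : HasDerivAt (fun s : ℝ => δ (x + s • (y - x)) - (1 - s) * δ x)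
      (fderiv ℝ δ x (y - x) - (-1) * δ x) 0 :=
    hψ.sub (((hasDerivAt_id (0 : ℝ)).const_sub 1).mul_const (δ x))
  have hmax : IsLocalMax (fun s : ℝ => δ (x + s • (y - x)) - (1 - s) * δ x) 0 := by
    filter_upwards [eventually_lt_nhds (zero_lt_one (α := ℝ))] with s hs
    have : δ (x + s • (y - x)) ≤ (1 - s) * δ x := by
      calc δ (x + s • (y - x)) ≤ dist (x + s • (y - x)) y := infDist_le_dist_of_mem hy
        _ = ‖(1 - s) • (x - y)‖ := by rw [dist_eq_norm]; congr 1; module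
        _ = (1 - s) * δ x := by
          rw [norm_smul, Real.norm_eq_abs, abs_of_pos (by linarith), ← dist_eq_norm, ← hxy]
    simpa using this
  have h0 := hmax.hasDerivAt_eq_zero hψ'
  have h1 := (fderiv ℝ δ x).le_opNorm (y - x)
  rw [← dist_eq_norm, dist_comm, ← hxy, Real.norm_eq_abs] at h1
  have h2 : fderiv ℝ δ x (y - x) = -δ x := by linarith
  rw [h2, abs_neg, abs_of_pos hpos] at h1
  exact le_of_mul_le_mul_right (by simpa using h1) hpos

end DistanceToBoundary

section HardyInequality

open Metric

theorem OrthonormalBasis.sum_apply_mul_apply_le {ι E : Type*} [Fintype ι] [NormedAddCommGroup E]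
    [InnerProductSpace ℝ E] [CompleteSpace E] (b : OrthonormalBasis ι ℝ E) (A B : E →L[ℝ] ℝ) :
    ∑ i, A (b i) * B (b i) ≤ ‖A‖ * ‖B‖ := by
  obtain ⟨x, rfl⟩ := (InnerProductSpace.toDual ℝ E).surjective A
  obtain ⟨y, rfl⟩ := (InnerProductSpace.toDual ℝ E).surjective B
  simp only [InnerProductSpace.toDual_apply_apply, LinearIsometryEquiv.norm_map]
  simp_rw [real_inner_comm (b _) y, b.sum_inner_mul_inner]
  exact real_inner_le_norm x y

theorem OrthonormalBasis.sum_sq_apply {ι E : Type*} [Fintype ι] [NormedAddCommGroup E]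
    [InnerProductSpace ℝ E] [CompleteSpace E] (b : OrthonormalBasis ι ℝ E) (A : E →L[ℝ] ℝ) :
    ∑ i, A (b i) ^ 2 = ‖A‖ ^ 2 := by
  obtain ⟨x, rfl⟩ := (InnerProductSpace.toDual ℝ E).surjective A
  simp only [InnerProductSpace.toDual_apply_apply, LinearIsometryEquiv.norm_map, sq]
  rw [← real_inner_self_eq_norm_mul_norm, ← b.sum_inner_mul_inner]
  simp_rw [real_inner_comm x]

theorem tsupport_abs_subset {E : Type*} [TopologicalSpace E] (f : E → ℝ) :
    tsupport (fun x => |f x|) ⊆ tsupport f :=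
  closure_mono fun x hx => by simpa using hx

theorem tsupport_norm_fderiv_subset {E : Type*} [NormedAddCommGroup E] [NormedSpace ℝ E]
    (f : E → ℝ) : tsupport (fun x => ‖fderiv ℝ f x‖) ⊆ tsupport f :=
  closure_minimal (fun x hx => support_fderiv_subset ℝ (f := f) (by simpa using hx))
    (isClosed_tsupport f)

theorem norm_fderiv_abs_le {E : Type*} [NormedAddCommGroup E] [NormedSpace ℝ E] {f : E → ℝ}
    {x : E} (hf : DifferentiableAt ℝ f x) :
    ‖fderiv ℝ (fun x => |f x|) x‖ ≤ ‖fderiv ℝ f x‖ := by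
  by_cases h0 : f x = 0
  · have hmin : IsLocalMin (fun x => |f x|) x := .of_forall fun y => by simp [h0]
    simp [hmin.fderiv_eq_zero]
  · rcases lt_or_gt_of_ne h0 with h | h
    · rw [(hf.hasFDerivAt.abs_of_neg h).fderiv, norm_neg]
    · rw [(hf.hasFDerivAt.abs_of_pos h).fderiv]

theorem LipschitzWith.mul_of_abs_le {E : Type*} [PseudoMetricSpace E] {f g : E → ℝ}
    {C D : NNReal} (hf : LipschitzWith C f) (hg : LipschitzWith D g) {A B : NNReal}
    (hA : ∀ x, |f x| ≤ A) (hB : ∀ x, |g x| ≤ B) :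
    LipschitzWith (A * D + B * C) fun x => f x * g x := by
  refine LipschitzWith.of_dist_le_mul fun x y => ?_
  have h1 := hf.dist_le_mul x y
  have h2 := hg.dist_le_mul x y
  rw [Real.dist_eq] at h1 h2 ⊢
  calc |f x * g x - f y * g y| = |f x * (g x - g y) + g y * (f x - f y)| := by ring_nf
    _ ≤ |f x| * |g x - g y| + |g y| * |f x - f y| := by
      rw [← abs_mul, ← abs_mul]; exact abs_add_le _ _
    _ ≤ A * (D * dist x y) + B * (C * dist x y) := by
      gcongr
      · exact hA x
      · exact hB y
    _ = _ := by push_cast; ring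

/-- A function that is continuously differentiable on the positive half-line can be modified away
from a given compact interval to become bounded and Lipschitz. -/
theorem exists_lipschitzWith_eqOn_Icc {Q q : ℝ → ℝ} (hQ : ∀ t, 0 < t → HasDerivAt Q (-q t) t)
    (hq : ContinuousOn q (Ioi 0)) {α β : ℝ} (hα : 0 < α) (hαβ : α ≤ β) :
    ∃ (R : ℝ → ℝ) (L B : NNReal), LipschitzWith L R ∧ (∀ t, |R t| ≤ B) ∧ EqOn R Q (Icc α β) := by
  have hpos : ∀ t ∈ Icc α β, 0 < t := fun t ht => hα.trans_le ht.1
  obtain ⟨L, hL⟩ := isCompact_Icc.exists_bound_of_continuousOn (hq.mono hpos)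
  obtain ⟨B, hB⟩ := isCompact_Icc.exists_bound_of_continuousOn
    (f := Q) (s := Icc α β) fun t ht => (hQ t (hpos t ht)).continuousAt.continuousWithinAt
  have hLip : LipschitzOnWith L.toNNReal Q (Icc α β) :=
    (convex_Icc α β).lipschitzOnWith_of_nnnorm_hasDerivWithin_le
      (fun t ht => (hQ t (hpos t ht)).hasDerivWithinAt) fun t ht => by
        rw [nnnorm_neg, ← NNReal.coe_le_coe, coe_nnnorm]
        exact (hL t ht).trans (Real.le_coe_toNNReal L)
  refine ⟨IccExtend hαβ ((Icc α β).domRestrict Q), L.toNNReal, B.toNNReal, ?_, fun t => ?_, ?_⟩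
  · simpa [IccExtend] using
      (lipschitzOnWith_iff_restrict.1 hLip).comp (LipschitzWith.projIcc hαβ)
  · exact (hB _ (projIcc α β hαβ t).2).trans (Real.le_coe_toNNReal B)
  · intro t ht
    rw [IccExtend_of_mem hαβ _ ht, domRestrict_apply]

variable {E : Type*} [NormedAddCommGroup E] [InnerProductSpace ℝ E] [FiniteDimensional ℝ E]
  [MeasurableSpace E] [BorelSpace E] {μ : Measure E} [μ.IsAddHaarMeasure]

theorem integrable_comp_infDist_frontier_mul {Ω : Set E} (hΩ : IsOpen Ω) (hΩu : Ω ≠ univ)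
    {h : ℝ → ℝ} (hh : ContinuousOn h (Ioi 0)) {k : E → ℝ} (hk : Continuous k)
    (hsupp : HasCompactSupport k) (hsuppΩ : tsupport k ⊆ Ω) :
    Integrable (fun x => h (infDist x (frontier Ω)) * k x) μ := by
  have hcont : ContinuousOn (fun x => h (infDist x (frontier Ω)) * k x) (tsupport k) :=
    (hh.comp (continuous_infDist_pt _).continuousOn fun x hx =>
      infDist_frontier_pos hΩ hΩu (hsuppΩ hx)).mul hk.continuousOn
  exact (hcont.integrableOn_compact hsupp).integrable_of_forall_notMem_eq_zero
    fun x hx => by simp [image_eq_zero_of_notMem_tsupport hx]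

/-- The `L¹` Hardy inequality on a convex set for a general weight `Q` of the distance to the
boundary and the opposite of its derivative as potential. -/
theorem Convex.integral_potential_mul_abs_le {Ω : Set E} (hconv : Convex ℝ Ω) (hΩ : IsOpen Ω)
    (hΩu : Ω ≠ univ) {Q q : ℝ → ℝ} (hQ : ∀ t, 0 < t → HasDerivAt Q (-q t) t)
    (hq : ContinuousOn q (Ioi 0)) (hQ0 : ∀ x ∈ Ω, 0 ≤ Q (infDist x (frontier Ω)))
    {f : E → ℝ} (hf : ContDiff ℝ 1 f) (hsupp : HasCompactSupport f) (hsuppΩ : tsupport f ⊆ Ω) :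
    ∫ x in Ω, q (infDist x (frontier Ω)) * |f x| ∂μ
      ≤ ∫ x in Ω, Q (infDist x (frontier Ω)) * ‖fderiv ℝ f x‖ ∂μ := by
  set δ : E → ℝ := fun x => infDist x (frontier Ω) with hδ_def
  have hδ : LipschitzWith 1 δ := lipschitz_infDist_pt _
  have hδpos : ∀ x ∈ Ω, 0 < δ x := fun x hx => infDist_frontier_pos hΩ hΩu hx
  have hQc : ContinuousOn Q (Ioi 0) := fun t ht => (hQ t ht).continuousAt.continuousWithinAt
  have hdf : Continuous fun x => ‖fderiv ℝ f x‖ := (hf.continuous_fderiv one_ne_zero).norm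
  have hsub := tsupport_norm_fderiv_subset f
  have hsub' := tsupport_abs_subset f
  have hint₁ : Integrable (fun x => q (δ x) * |f x|) μ :=
    integrable_comp_infDist_frontier_mul hΩ hΩu hq hf.continuous.abs
      (hsupp.abs) (hsub'.trans hsuppΩ)
  have hint₂ : Integrable (fun x => Q (δ x) * ‖fderiv ℝ f x‖) μ :=
    integrable_comp_infDist_frontier_mul hΩ hΩu hQc hdf
      (hsupp.of_isClosed_subset (isClosed_tsupport _) hsub) (hsub.trans hsuppΩ)
  have hf0 : ∀ x ∉ Ω, f x = 0 := fun x hx =>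
    image_eq_zero_of_notMem_tsupport fun h => hx (hsuppΩ h)
  have hdf0 : ∀ x ∉ tsupport f, fderiv ℝ f x = 0 := fun x hx => fderiv_of_notMem_tsupport ℝ hx
  rw [setIntegral_eq_integral_of_forall_compl_eq_zero fun x hx => by simp [hf0 x hx],
    setIntegral_eq_integral_of_forall_compl_eq_zero fun x hx => by
      simp [hdf0 x fun h => hx (hsuppΩ h)]]
  -- the values of `δ` on the support of `f` lie inside a compact interval of `(0, ∞)`
  obtain ⟨α, β, hα, hαβ, hmem⟩ : ∃ α β : ℝ, 0 < α ∧ α ≤ β ∧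
      ∀ x ∈ tsupport f, δ x ∈ Ioo α β := by
    rcases (tsupport f).eq_empty_or_nonempty with he | hne
    · exact ⟨1, 1, one_pos, le_rfl, by simp [he]⟩
    obtain ⟨x₀, hx₀, hmin⟩ := hsupp.isCompact.exists_isMinOn hne hδ.continuous.continuousOn
    obtain ⟨x₁, hx₁, hmax⟩ := hsupp.isCompact.exists_isMaxOn hne hδ.continuous.continuousOn
    have h0 := hδpos x₀ (hsuppΩ hx₀)
    have h01 : δ x₀ ≤ δ x₁ := hmin hx₁
    refine ⟨δ x₀ / 2, δ x₁ + 1, half_pos h0, by linarith, fun x hx => ⟨?_, ?_⟩⟩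
    · have : δ x₀ ≤ δ x := hmin hx
      linarith
    · have : δ x ≤ δ x₁ := hmax hx
      linarith
  obtain ⟨R, L, B, hRL, hRB, hRQ⟩ := exists_lipschitzWith_eqOn_Icc hQ hq hα hαβ
  obtain ⟨C, hfC⟩ := hf.lipschitzWith_of_hasCompactSupport hsupp one_ne_zero
  have hfabs : LipschitzWith C fun x => |f x| := by
    simpa [Function.comp_def] using (lipschitzWith_one_norm (E := ℝ)).comp hfC
  obtain ⟨A, hA⟩ := hsupp.exists_bound_of_continuous hf.continuous
  have hA' : ∀ x, |(|f x|)| ≤ A.toNNReal := fun x => by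
    rw [abs_abs]; exact (hA x).trans (Real.le_coe_toNNReal A)
  set φ : E → ℝ := fun x => |f x| * R (δ x) with hφ_def
  have hφ : LipschitzWith _ φ := hfabs.mul_of_abs_le (hRL.comp hδ) hA' fun x => hRB (δ x)
  have hφsupp : tsupport φ ⊆ tsupport f :=
    closure_mono fun x hx => by
      simp only [hφ_def, Function.mem_support, ne_eq, mul_eq_zero, abs_eq_zero, not_or] at hx
      exact hx.1
  have hφcomp : HasCompactSupport φ := hsupp.of_isClosed_subset (isClosed_tsupport _) hφsupp
  have hφ0 : ∀ x, 0 ≤ φ x := by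
    intro x
    by_cases hx : x ∈ tsupport f
    · have h := hmem x hx
      simp only [hφ_def]
      rw [hRQ ⟨h.1.le, h.2.le⟩]
      exact mul_nonneg (abs_nonneg _) (hQ0 x (hsuppΩ hx))
    · simp [hφ_def, image_eq_zero_of_notMem_tsupport hx]
  set b := stdOrthonormalBasis ℝ E
  have hnonneg : 0 ≤ ∫ x, ∑ i, lineDeriv ℝ δ x (b i) * lineDeriv ℝ φ x (b i) ∂μ := by
    rw [integral_finsetSum _ fun i _ =>
      hδ.integrable_lineDeriv_mul_lineDeriv hφ hφcomp (b i)]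
    exact Finset.sum_nonneg fun i _ =>
      (hconv.concaveOn_infDist_frontier hΩ hΩu).integral_lineDeriv_mul_lineDeriv_nonneg hΩ hδ hφ
        hφcomp (hφsupp.trans hsuppΩ) hφ0 (b i)
  have hle : ∫ x, ∑ i, lineDeriv ℝ δ x (b i) * lineDeriv ℝ φ x (b i) ∂μ
      ≤ ∫ x, (Q (δ x) * ‖fderiv ℝ f x‖ - q (δ x) * |f x|) ∂μ := by
    refine integral_mono_ae (integrable_finsetSum _ fun i _ =>
      hδ.integrable_lineDeriv_mul_lineDeriv hφ hφcomp (b i)) (hint₂.sub hint₁) ?_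
    filter_upwards [hδ.ae_differentiableAt (μ := μ), hfabs.ae_differentiableAt (μ := μ)]
      with x hxδ hxf
    by_cases hx : x ∈ tsupport f
    · have hxΩ := hsuppΩ hx
      have hRQx : R (δ x) = Q (δ x) := hRQ ⟨(hmem x hx).1.le, (hmem x hx).2.le⟩
      have hR : HasDerivAt R (-q (δ x)) (δ x) :=
        (hQ _ (hδpos x hxΩ)).congr_of_eventuallyEq
          (hRQ.eventuallyEq_of_mem (Icc_mem_nhds (hmem x hx).1 (hmem x hx).2))
      have hder := hxf.hasFDerivAt.mul (hR.comp_hasFDerivAt x hxδ.hasFDerivAt)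
      have hlineφ : ∀ i, lineDeriv ℝ φ x (b i) = |f x| * (-q (δ x) * fderiv ℝ δ x (b i))
          + Q (δ x) * fderiv ℝ (fun x => |f x|) x (b i) := by
        intro i
        rw [← hRQx]
        exact (hder.hasLineDerivAt (b i)).lineDeriv
      simp only [hlineφ, hxδ.lineDeriv_eq_fderiv]
      have hsum : ∑ i, fderiv ℝ δ x (b i) * (|f x| * (-q (δ x) * fderiv ℝ δ x (b i))
            + Q (δ x) * fderiv ℝ (fun x => |f x|) x (b i))
          = Q (δ x) * (∑ i, fderiv ℝ δ x (b i) * fderiv ℝ (fun x => |f x|) x (b i))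
            - q (δ x) * |f x| * ∑ i, fderiv ℝ δ x (b i) ^ 2 := by
        rw [Finset.mul_sum, Finset.mul_sum, ← Finset.sum_sub_distrib]
        exact Finset.sum_congr rfl fun i _ => by ring
      have heik : ‖fderiv ℝ δ x‖ = 1 := norm_fderiv_infDist_frontier hΩ hΩu hxΩ hxδ
      rw [hsum, b.sum_sq_apply, heik, one_pow, mul_one]
      have h1 := b.sum_apply_mul_apply_le (fderiv ℝ δ x) (fderiv ℝ (fun x => |f x|) x)
      rw [heik, one_mul] at h1
      have h2 := h1.trans (norm_fderiv_abs_le (hf.differentiable one_ne_zero x))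
      have := mul_le_mul_of_nonneg_left h2 (hQ0 x hxΩ)
      linarith
    · have h1 : ∀ i, lineDeriv ℝ φ x (b i) = 0 := fun i =>
        lineDeriv_eq_zero_of_notMem_tsupport (fun h => hx (hφsupp h)) (b i)
      simp [h1, hdf0 x hx, image_eq_zero_of_notMem_tsupport hx]
  rw [integral_sub hint₂ hint₁] at hle
  linarith

end HardyInequality

theorem stmt_16 (n : ℕ) (Ω : Set (EuclideanSpace ℝ (Fin n)))
    (hΩo : IsOpen Ω) (hΩconv : Convex ℝ Ω) (hΩne : Ω.Nonempty) (hΩproper : Ω ≠ Set.univ)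
    (δ₀ : ℝ) (hδ₀ : IsLUB ((fun x => Metric.infDist x (frontier Ω)) '' Ω) δ₀)
    (m ν lam c jν : ℝ)
    (hm : 0 < m) (hν : ν ∈ Set.Ioc 0 (1 / m))
    (hlam : lam ∈ Set.Ico 0 ((1 + ν * m) / 2))
    (hc : 0 < c)
    (hjν_pos : 0 < jν) (hjν_zero : besselJ ν jν = 0)
    (hjν_first : ∀ t ∈ Set.Ioo 0 jν, 0 < besselJ ν t)
    (hcm : 2 * c / m ∈ Set.Ioo 0 jν)
    (hroot : (1 - 2 * lam) * besselJ ν (2 * c / m)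
      + 2 * c * deriv (besselJ ν) (2 * c / m) = 0)
    (f : EuclideanSpace ℝ (Fin n) → ℝ)
    (hf : ContDiff ℝ 1 f) (hsupp : HasCompactSupport f) (hsuppΩ : tsupport f ⊆ Ω)
    (hL1 : IntegrableOn (fun x => ‖fderiv ℝ f x‖ / Metric.infDist x (frontier Ω)) Ω) :
    (1 - ν ^ 2 * m ^ 2) / 4 * (∫ x in Ω, |f x| / (Metric.infDist x (frontier Ω)) ^ 2)
      + c ^ 2 / δ₀ ^ m * (∫ x in Ω, |f x| / (Metric.infDist x (frontier Ω)) ^ ((2:ℝ) - m))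
    ≤ ((1 + ν * m) / 2 - lam ^ 2) * (∫ x in Ω, ‖fderiv ℝ f x‖ / Metric.infDist x (frontier Ω))
      + (lam ^ 2 - lam) / δ₀ * (∫ x in Ω, ‖fderiv ℝ f x‖) := by
  have hpos : ∀ x ∈ Ω, 0 < Metric.infDist x (frontier Ω) := fun x hx =>
    infDist_frontier_pos hΩo hΩproper hx
  have hle : ∀ x ∈ Ω, Metric.infDist x (frontier Ω) ≤ δ₀ := fun x hx =>
    hδ₀.1 (mem_image_of_mem _ hx)
  have ha : 0 < δ₀ := let ⟨x, hx⟩ := hΩne; (hpos x hx).trans_le (hle x hx)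
  obtain ⟨Q, hQ, hQle⟩ := exists_antideriv_hardyPotential_le hm hν hlam.1 hc ha
    (fun x hx => hjν_first x ⟨hx.1, hx.2.trans_lt hcm.2⟩) hroot
  have hardy := hΩconv.integral_potential_mul_abs_le (μ := volume) hΩo hΩproper hQ
    (continuousOn_hardyPotential m ν c δ₀) (fun x hx => (hQle _ ⟨hpos x hx, hle x hx⟩).1)
    hf hsupp hsuppΩ
  have hsub := tsupport_abs_subset f
  have hsub' := tsupport_norm_fderiv_subset f
  have hdf : Continuous fun x => ‖fderiv ℝ f x‖ := (hf.continuous_fderiv one_ne_zero).norm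
  have hint₁ : IntegrableOn (fun x => |f x| / Metric.infDist x (frontier Ω) ^ 2) Ω := by
    have := integrable_comp_infDist_frontier_mul (μ := volume) hΩo hΩproper
      ((continuousOn_pow 2).inv₀ fun t (ht : 0 < t) => by positivity)
      hf.continuous.abs hsupp.abs (hsub.trans hsuppΩ)
    simpa only [div_eq_inv_mul, Pi.inv_apply, id] using this.integrableOn
  have hint₂ : IntegrableOn (fun x => |f x| / Metric.infDist x (frontier Ω) ^ ((2 : ℝ) - m)) Ω := by
    have := integrable_comp_infDist_frontier_mul (μ := volume) hΩo hΩproper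
      ((continuousOn_id.rpow_const fun t (ht : 0 < t) => Or.inl ht.ne').inv₀
        fun t (ht : 0 < t) => (rpow_pos_of_pos ht (2 - m)).ne')
      hf.continuous.abs hsupp.abs (hsub.trans hsuppΩ)
    simpa only [div_eq_inv_mul, Pi.inv_apply, id] using this.integrableOn
  have hdfcomp : HasCompactSupport fun x => ‖fderiv ℝ f x‖ :=
    hsupp.of_isClosed_subset (isClosed_tsupport _) hsub'
  have hint₃ : IntegrableOn (fun x => ‖fderiv ℝ f x‖) Ω :=
    (hdf.integrable_of_hasCompactSupport hdfcomp).integrableOn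
  have hintQ : IntegrableOn (fun x => Q (Metric.infDist x (frontier Ω)) * ‖fderiv ℝ f x‖) Ω :=
    (integrable_comp_infDist_frontier_mul hΩo hΩproper
      (fun t ht => (hQ t ht).continuousAt.continuousWithinAt) hdf hdfcomp
      (hsub'.trans hsuppΩ)).integrableOn
  calc _ = ∫ x in Ω, hardyPotential m ν c δ₀ (Metric.infDist x (frontier Ω)) * |f x| := by
        rw [← integral_const_mul, ← integral_const_mul,
          ← integral_add (hint₁.const_mul _) (hint₂.const_mul _)]
        refine integral_congr_ae (.of_forall fun x => ?_)
        simp only [hardyPotential]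
        ring
    _ ≤ _ := hardy
    _ ≤ ∫ x in Ω, (((1 + ν * m) / 2 - lam ^ 2) * (‖fderiv ℝ f x‖ / Metric.infDist x (frontier Ω))
          + (lam ^ 2 - lam) / δ₀ * ‖fderiv ℝ f x‖) := by
        refine setIntegral_mono_on hintQ ((hL1.const_mul _).add (hint₃.const_mul _))
          hΩo.measurableSet fun x hx => ?_
        have := mul_le_mul_of_nonneg_right (hQle _ ⟨hpos x hx, hle x hx⟩).2
          (norm_nonneg (fderiv ℝ f x))
        refine this.trans_eq ?_
        ring
    _ = _ := by
        rw [integral_add (hL1.const_mul _) (hint₃.const_mul _), integral_const_mul,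
          integral_const_mul]
end
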